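/- arXiv:1312.2259 — 3 statements merged into one kernel-verified Lean document; each statement's English description precedes it below -/
import Mathlib

section
/- Let v be a primitive invertible two-letter substitution sequence, let 𝔭 ∈ ℝ∖{0} and 𝔮 ∈ ℝ with (𝔭,𝔮) ≠ (1,0). Then for every ω in the hull Ω_v, the spectrum of H_{ω,(𝔭,𝔮)} equals the spectrum of H_{v,(𝔭,𝔮)}; that is, Σ_{ω,(𝔭,𝔮)} = Σ_{v,(𝔭,𝔮)}. -/
open Filter Topology

/-- Extension of a two-letter substitution (letters `false ↔ 0`, `true ↔ 1`)
to finite words by concatenation. -/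
def applySubst (s : Bool → List Bool) (w : List Bool) : List Bool := w.flatMap s

/-- `substPow s k b` is the word `s^k(b)`. -/
def substPow (s : Bool → List Bool) : ℕ → Bool → List Bool
  | 0, b => [b]
  | k + 1, b => applySubst s (substPow s k b)

/-- The image of a finite word in the free group on two letters. -/
def wordToFree (w : List Bool) : FreeGroup Bool := (w.map FreeGroup.of).prod

/-- A primitive invertible two-letter substitution. -/
structure IsPrimitiveInvertibleSubst (s : Bool → List Bool) : Prop where
  primitive : ∃ k : ℕ, ∀ b b' : Bool, b' ∈ substPow s k b
  invertible : ∃ φ : FreeGroup Bool ≃* FreeGroup Bool,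
      ∀ b : Bool, φ (FreeGroup.of b) = wordToFree (s b)

/-- `w` is a prefix of the one-sided infinite sequence `u`. -/
def SeqPrefix (w : List Bool) (u : ℕ → Bool) : Prop :=
  ∀ i : ℕ, ∀ h : i < w.length, w.get ⟨i, h⟩ = u i

/-- `u` is a fixed point of the substitution `s`: for each `m`, the word
`s(u 0)s(u 1)⋯s(u (m-1))` is a prefix of `u`. -/
def FixedPointOfSubst (s : Bool → List Bool) (u : ℕ → Bool) : Prop :=
  ∀ m : ℕ, SeqPrefix (applySubst s ((List.range m).map u)) u

/-- `v : ℤ → Bool` is the substitution sequence generated by the primitive invertible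
substitution `s` (with `s(0)` beginning in `0`): a rotation sequence for some irrational
`α ∈ (0,1)` and phase `β`, whose restriction to `ℕ` is a fixed point of `s`. -/
def IsSubstSeqOf (s : Bool → List Bool) (v : ℤ → Bool) : Prop :=
  IsPrimitiveInvertibleSubst s ∧ (s false).head? = some false ∧
    FixedPointOfSubst s (fun n : ℕ => v (n : ℤ)) ∧
    ∃ α β : ℝ, Irrational α ∧ α ∈ Set.Ioo (0 : ℝ) 1 ∧
      ∀ n : ℤ, (v n = true ↔ Int.fract ((n : ℝ) * α + β) ∈ Set.Ico (1 - α) 1)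

/-- `v` is a primitive invertible two-letter substitution sequence. -/
def IsSubstSeq (v : ℤ → Bool) : Prop := ∃ s, IsSubstSeqOf s v

/-- The hull of `v`: limits in the product topology of left shifts `T^{n_i}(v)`, `n_i ↑ ∞`. -/
def Hull (v : ℤ → Bool) : Set (ℤ → Bool) :=
  {ν | ∃ n : ℕ → ℕ, StrictMono n ∧ ∀ m : ℤ, ∀ᶠ i in atTop, v (m + (n i : ℤ)) = ν m}

noncomputable section

instance : Fact ((1 : ENNReal) ≤ 2) := ⟨one_le_two⟩

/-- The Hilbert space `ℓ²(ℤ, ℂ)`. -/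
abbrev JacobiSpace : Type := lp (fun _ : ℤ => ℂ) 2

/-- Hopping coefficients: `p(0) = 1`, `p(1) = 𝔭`. -/
def pCoef (𝔭 : ℝ) (b : Bool) : ℝ := if b then 𝔭 else 1

/-- Potential coefficients: `q(0) = 0`, `q(1) = 𝔮`. -/
def qCoef (𝔮 : ℝ) (b : Bool) : ℝ := if b then 𝔮 else 0

/-- `H` is the Jacobi operator with hopping `p ∘ ω` and potential `q ∘ ω`:
`(Hφ)_n = p(ω_{n+1}) φ_{n+1} + p(ω_n) φ_{n-1} + q(ω_n) φ_n`. -/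
def IsJacobi (𝔭 𝔮 : ℝ) (ω : ℤ → Bool) (H : JacobiSpace →L[ℂ] JacobiSpace) : Prop :=
  ∀ φ : JacobiSpace, ∀ n : ℤ,
    (H φ : ∀ _ : ℤ, ℂ) n =
      (pCoef 𝔭 (ω (n + 1)) : ℂ) * (φ : ∀ _ : ℤ, ℂ) (n + 1) +
      (pCoef 𝔭 (ω n) : ℂ) * (φ : ∀ _ : ℤ, ℂ) (n - 1) +
      (qCoef 𝔮 (ω n) : ℂ) * (φ : ∀ _ : ℤ, ℂ) n

/-- The spectrum of the Jacobi operator `H_{ω,(𝔭,𝔮)}`, regarded as a subset of `ℝ`. -/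
def jacobiSpectrum (𝔭 𝔮 : ℝ) (ω : ℤ → Bool) : Set ℝ :=
  {E : ℝ | ∀ H : JacobiSpace →L[ℂ] JacobiSpace, IsJacobi 𝔭 𝔮 ω H → (E : ℂ) ∈ spectrum ℂ H}

end

/-! ### Combinatorics of rotation sequences -/

/-- Uniform hitting times of an irrational rotation. -/
theorem uniform_hit (α : ℝ) (hα : Irrational α) (δ : ℝ) (hδ : 0 < δ) :
    ∃ N : ℕ, ∀ t : ℝ, ∃ j l : ℤ, |j| ≤ N ∧ t + j * α + l ∈ Set.Ioo 0 δ := by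
  have hd : Dense (AddSubgroup.closure {α, 1} : Set ℝ) := by
    rw [dense_addSubgroupClosure_pair_iff]; simpa using hα
  have hcov : Set.Icc (0 : ℝ) 1 ⊆
      ⋃ i : ℤ × ℤ, {t : ℝ | t + i.1 * α + i.2 ∈ Set.Ioo 0 δ} := by
    intro t _
    obtain ⟨g, hg, hg1, hg2⟩ := hd.exists_between (show -t < δ - t by linarith)
    obtain ⟨j, l, hjl⟩ := AddSubgroup.mem_closure_pair.1 hg
    simp only [zsmul_eq_mul, mul_one] at hjl
    refine Set.mem_iUnion.2 ⟨(j, l), ?_, ?_⟩ <;> simp only <;> linarith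
  obtain ⟨F, hF⟩ := isCompact_Icc.elim_finite_subcover _
    (fun i : ℤ × ℤ => isOpen_Ioo.preimage
      (show Continuous (fun t : ℝ => t + i.1 * α + i.2) by fun_prop)) hcov
  refine ⟨F.sup (fun i => i.1.natAbs), fun t => ?_⟩
  have ht := hF (show Int.fract t ∈ Set.Icc (0 : ℝ) 1 from
    ⟨Int.fract_nonneg t, (Int.fract_lt_one t).le⟩)
  simp only [Set.mem_iUnion] at ht
  obtain ⟨i, hi, hti⟩ := ht
  refine ⟨i.1, i.2 - ⌊t⌋, ?_, ?_⟩
  · have : i.1.natAbs ≤ F.sup (fun i => i.1.natAbs) := Finset.le_sup (f := fun i : ℤ × ℤ => i.1.natAbs) hi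
    rw [Int.abs_eq_natAbs]
    exact_mod_cast this
  · have h2 : Int.fract t + i.1 * α + i.2 ∈ Set.Ioo 0 δ := hti
    rw [Int.fract] at h2
    push_cast
    convert h2 using 1
    ring

/-- The coding of the rotation is locally constant to the right. -/
theorem right_const (a x : ℝ) :
    ∃ δ > 0, ∀ t ∈ Set.Ioo 0 δ, ∀ l : ℤ,
      (Int.fract (x + t + l) ∈ Set.Ico (1 - a) 1 ↔ Int.fract x ∈ Set.Ico (1 - a) 1) := by
  have h1 := Int.fract_lt_one x
  have h0 := Int.fract_nonneg x
  have key : ∀ t : ℝ, 0 < t → t < 1 - Int.fract x → ∀ l : ℤ,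
      Int.fract (x + t + l) = Int.fract x + t := by
    intro t ht0 ht l
    rw [Int.fract_add_intCast, Int.fract_eq_iff]
    refine ⟨by linarith, by linarith, ⌊x⌋, ?_⟩
    rw [Int.fract]; ring
  by_cases h : 1 - a ≤ Int.fract x
  · refine ⟨1 - Int.fract x, by linarith, fun t ht l => ?_⟩
    rw [key t ht.1 ht.2 l]
    have := ht.1
    have := ht.2
    constructor <;> intro _ <;> constructor <;> linarith
  · push Not at h
    refine ⟨min (1 - Int.fract x) (1 - a - Int.fract x), lt_min (by linarith) (by linarith),
      fun t ht l => ?_⟩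
    have h2 := lt_min_iff.1 ht.2
    rw [key t ht.1 h2.1 l]
    constructor <;> intro h3 <;> linarith [h3.1]

/-- Every finite pattern of `v` recurs with bounded gaps. -/
theorem uniform_recurrence (v : ℤ → Bool) (α β : ℝ) (hα : Irrational α)
    (hv : ∀ n : ℤ, (v n = true ↔ Int.fract ((n : ℝ) * α + β) ∈ Set.Ico (1 - α) 1)) (L : ℕ) :
    ∃ N : ℕ, ∀ k : ℤ, ∃ j : ℤ, |j| ≤ N ∧ ∀ m : ℤ, |m| ≤ L → v (m + (k + j)) = v m := by
  choose d hd0 hd using fun m : ℤ => right_const α (m * α + β)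
  obtain ⟨δ, hδ0, hδ⟩ : ∃ δ > 0, ∀ m ∈ Finset.Icc (-(L : ℤ)) L, δ ≤ d m := by
    have hne : (Finset.Icc (-(L : ℤ)) L).Nonempty := ⟨0, by simp⟩
    refine ⟨(Finset.Icc (-(L : ℤ)) L).inf' hne d, ?_, fun m hm => Finset.inf'_le _ hm⟩
    exact (Finset.lt_inf'_iff hne).2 fun m _ => hd0 m
  obtain ⟨N, hN⟩ := uniform_hit α hα δ hδ0
  refine ⟨N, fun k => ?_⟩
  obtain ⟨j, l, hj, hjl⟩ := hN (k * α)
  refine ⟨j, hj, fun m hm => ?_⟩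
  rw [Bool.eq_iff_iff, hv, hv]
  have h1 := hd m (k * α + j * α + l)
    ⟨hjl.1, hjl.2.trans_le (hδ m (Finset.mem_Icc.2 (abs_le.1 hm)))⟩ (-l)
  rw [← h1]
  have h2 : ((m + (k + j) : ℤ) : ℝ) * α + β =
      m * α + β + (k * α + j * α + l) + ((-l : ℤ) : ℝ) := by
    push_cast; ring
  rw [h2]

/-! ### Operator theory -/

theorem jacobi_selfAdjoint {𝔭 𝔮 : ℝ} {ω : ℤ → Bool} {H : JacobiSpace →L[ℂ] JacobiSpace}
    (hH : IsJacobi 𝔭 𝔮 ω H) : IsSelfAdjoint H := by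
  rw [ContinuousLinearMap.isSelfAdjoint_iff']
  ext φ n
  have h1 : H (lp.single 2 n (1 : ℂ)) =
      lp.single 2 (n - 1) (pCoef 𝔭 (ω n) : ℂ) + lp.single 2 (n + 1) (pCoef 𝔭 (ω (n + 1)) : ℂ)
        + lp.single 2 n (qCoef 𝔮 (ω n) : ℂ) := by
    ext m
    rw [hH]
    simp only [lp.coeFn_add, Pi.add_apply, lp.single_apply, Pi.single_apply]
    by_cases a : m = n
    · subst a
      have h3 : ¬ m = m - 1 := by omega
      simp [h3]
    · by_cases b : m = n - 1
      · subst b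
        have h3 : ¬ n - 1 - 1 = n := by omega
        have h4 : ¬ n - 1 = n + 1 := by omega
        simp [h3, h4]
      · by_cases c : m = n + 1
        · subst c
          have h3 : ¬ n + 1 + 1 = n := by omega
          simp [h3, b]
        · have b' : ¬ m + 1 = n := by omega
          have c' : ¬ m - 1 = n := by omega
          simp [a, b, c, b', c']
  have h2 : (ContinuousLinearMap.adjoint H φ : ∀ _ : ℤ, ℂ) n =
      inner ℂ (lp.single 2 n (1 : ℂ) : JacobiSpace) (ContinuousLinearMap.adjoint H φ) := by
    rw [lp.inner_single_left]; simp
  rw [h2, ContinuousLinearMap.adjoint_inner_right, h1, inner_add_left, inner_add_left,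
    lp.inner_single_left, lp.inner_single_left, lp.inner_single_left, hH]
  simp
  ring

theorem isUnit_of_bound {A : JacobiSpace →L[ℂ] JacobiSpace} (hA : IsSelfAdjoint A)
    {ε : ℝ} (hε : 0 < ε) (h : ∀ φ, ε * ‖φ‖ ≤ ‖A φ‖) : IsUnit A := by
  rw [ContinuousLinearMap.isUnit_iff_bijective,
    ContinuousLinearMap.bijective_iff_dense_range_and_antilipschitz]
  constructor
  · rw [Submodule.topologicalClosure_eq_top_iff, ContinuousLinearMap.orthogonal_range,
      ContinuousLinearMap.isSelfAdjoint_iff'.1 hA]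
    rw [eq_bot_iff]
    intro φ hφ
    have h0 : A φ = 0 := hφ
    have h1 := h φ
    rw [h0, norm_zero] at h1
    have h2 : ‖φ‖ = 0 := le_antisymm (by nlinarith [norm_nonneg φ]) (norm_nonneg φ)
    simpa using h2
  · refine ⟨⟨ε⁻¹, by positivity⟩, A.antilipschitz_of_bound fun φ => ?_⟩
    show ‖φ‖ ≤ ε⁻¹ * ‖A φ‖
    rw [inv_mul_eq_div, le_div_iff₀ hε, mul_comm]
    exact h φ

theorem bound_of_isUnit {A : JacobiSpace →L[ℂ] JacobiSpace} (hA : IsUnit A) :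
    ∃ ε > 0, ∀ φ, ε * ‖φ‖ ≤ ‖A φ‖ := by
  obtain ⟨u, rfl⟩ := hA
  set B : JacobiSpace →L[ℂ] JacobiSpace := ↑u⁻¹ with hB
  have hpos : 0 < ‖B‖ + 1 := by positivity
  refine ⟨(‖B‖ + 1)⁻¹, by positivity, fun φ => ?_⟩
  rw [inv_mul_le_iff₀ hpos]
  have h1 : B ((u : JacobiSpace →L[ℂ] JacobiSpace) φ) = φ := by
    rw [← mul_apply_eq_comp, hB, Units.inv_mul]; rfl
  have h2 := B.le_opNorm ((u : JacobiSpace →L[ℂ] JacobiSpace) φ)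
  rw [h1] at h2
  nlinarith [norm_nonneg ((u : JacobiSpace →L[ℂ] JacobiSpace) φ)]

theorem norm_eq_of_shift (f g : JacobiSpace) (k : ℤ)
    (h : ∀ n : ℤ, (g : ∀ _ : ℤ, ℂ) (n + k) = (f : ∀ _ : ℤ, ℂ) n) : ‖g‖ = ‖f‖ := by
  rw [lp.norm_eq_tsum_rpow (by norm_num), lp.norm_eq_tsum_rpow (by norm_num)]
  congr 1
  rw [← (Equiv.addRight k).tsum_eq]
  simp [h]

/-- If every finite pattern of `ω` occurs in `ω'` then the spectrum of `ω` is contained in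
that of `ω'`. -/
theorem spectrum_subset_of_patterns {𝔭 𝔮 : ℝ} {ω ω' : ℤ → Bool}
    {H H' : JacobiSpace →L[ℂ] JacobiSpace}
    (hH : IsJacobi 𝔭 𝔮 ω H) (hH' : IsJacobi 𝔭 𝔮 ω' H')
    (hpat : ∀ L : ℕ, ∃ k : ℤ, ∀ m : ℤ, |m| ≤ L → ω' (m + k) = ω m) (E : ℝ)
    (hE : (E : ℂ) ∈ spectrum ℂ H) : (E : ℂ) ∈ spectrum ℂ H' := by
  rw [spectrum.mem_iff] at hE ⊢
  intro hu
  apply hE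
  obtain ⟨ε, hε, hb⟩ := bound_of_isUnit hu
  have hsa : IsSelfAdjoint (algebraMap ℂ (JacobiSpace →L[ℂ] JacobiSpace) (E : ℂ) - H) := by
    refine IsSelfAdjoint.sub ?_ (jacobi_selfAdjoint hH)
    rw [isSelfAdjoint_iff, ← algebraMap_star_comm]
    simp
  refine isUnit_of_bound hsa hε fun φ => ?_
  have hlim := lp.hasSum_single (p := 2) (by simp) φ
  rw [HasSum] at hlim
  have hc1 : Tendsto (fun s : Finset ℤ => ε * ‖∑ i ∈ s, lp.single 2 i (φ i)‖)
      (SummationFilter.unconditional ℤ).filter (𝓝 (ε * ‖φ‖)) :=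
    (hlim.norm).const_mul ε
  have hc2 : Tendsto (fun s : Finset ℤ =>
      ‖(algebraMap ℂ (JacobiSpace →L[ℂ] JacobiSpace) (E : ℂ) - H) (∑ i ∈ s, lp.single 2 i (φ i))‖)
      (SummationFilter.unconditional ℤ).filter
      (𝓝 ‖(algebraMap ℂ (JacobiSpace →L[ℂ] JacobiSpace) (E : ℂ) - H) φ‖) :=
    ((ContinuousLinearMap.continuous _).tendsto φ |>.comp hlim).norm
  refine le_of_tendsto_of_tendsto' hc1 hc2 fun s => ?_
  set f : JacobiSpace := ∑ i ∈ s, lp.single 2 i (φ i) with hf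
  obtain ⟨k, hk⟩ := hpat (s.sup Int.natAbs + 1)
  set g : JacobiSpace := ∑ i ∈ s, lp.single 2 (i + k) (φ i) with hg
  have hfg : ∀ n : ℤ, (g : ∀ _ : ℤ, ℂ) (n + k) = (f : ∀ _ : ℤ, ℂ) n := by
    intro n
    rw [hf, hg, lp.coeFn_sum, lp.coeFn_sum]
    simp [Finset.sum_apply, Pi.single_apply]
  have hsupp : ∀ n : ℤ, (f : ∀ _ : ℤ, ℂ) n ≠ 0 → |n| ≤ (s.sup Int.natAbs : ℕ) := by
    intro n hn
    have hns : n ∈ s := by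
      by_contra hns
      apply hn
      rw [hf, lp.coeFn_sum]
      simp [Finset.sum_apply, Pi.single_apply, hns]
    have : n.natAbs ≤ s.sup Int.natAbs := Finset.le_sup (f := Int.natAbs) hns
    rw [Int.abs_eq_natAbs]
    exact_mod_cast this
  rw [← norm_eq_of_shift f g k hfg]
  refine (hb g).trans_eq (norm_eq_of_shift _ _ k fun n => ?_)
  have e1 : ((algebraMap ℂ (JacobiSpace →L[ℂ] JacobiSpace) (E : ℂ) - H') g : ∀ _ : ℤ, ℂ) (n + k)
      = E * (g : ∀ _ : ℤ, ℂ) (n + k) - (H' g : ∀ _ : ℤ, ℂ) (n + k) := by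
    rw [Algebra.algebraMap_eq_smul_one]
    rfl
  have e2 : ((algebraMap ℂ (JacobiSpace →L[ℂ] JacobiSpace) (E : ℂ) - H) f : ∀ _ : ℤ, ℂ) n
      = E * (f : ∀ _ : ℤ, ℂ) n - (H f : ∀ _ : ℤ, ℂ) n := by
    rw [Algebra.algebraMap_eq_smul_one]
    rfl
  rw [e1, e2, hH', hH, show n + k + 1 = (n + 1) + k by ring, show n + k - 1 = (n - 1) + k by ring,
    hfg, hfg, hfg]
  congr 1
  congr 1
  congr 1
  · by_cases h0 : (f : ∀ _ : ℤ, ℂ) (n + 1) = 0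
    · rw [h0]; simp
    · rw [hk (n + 1) (by have := hsupp _ h0; push_cast at *; linarith)]
  · by_cases h0 : (f : ∀ _ : ℤ, ℂ) (n - 1) = 0
    · rw [h0]; simp
    · rw [hk n (by have := hsupp _ h0; push_cast at *; grind)]
  · by_cases h0 : (f : ∀ _ : ℤ, ℂ) n = 0
    · rw [h0]; simp
    · rw [hk n (by have := hsupp _ h0; push_cast at *; linarith)]

/-- For a primitive invertible two-letter substitution sequence `v` and
`(𝔭,𝔮) ≠ (1,0)`, `𝔭 ≠ 0`, for every `ω` in the hull of `v`, the spectrum of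
`H_{ω,(𝔭,𝔮)}` (as a subset of `ℝ`) equals the spectrum of `H_{v,(𝔭,𝔮)}`. -/
theorem spectrum_constant_on_hull (v : ℤ → Bool) (hv : IsSubstSeq v)
    (𝔭 𝔮 : ℝ) (h𝔭 : 𝔭 ≠ 0) (hpq : (𝔭, 𝔮) ≠ (1, 0))
    (ω : ℤ → Bool) (hω : ω ∈ Hull v)
    (Hω Hv : JacobiSpace →L[ℂ] JacobiSpace)
    (hHω : IsJacobi 𝔭 𝔮 ω Hω) (hHv : IsJacobi 𝔭 𝔮 v Hv) :
    {E : ℝ | (E : ℂ) ∈ spectrum ℂ Hω} = {E : ℝ | (E : ℂ) ∈ spectrum ℂ Hv} := by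
  obtain ⟨s, -, -, -, α, β, hα, -, hv⟩ := hv
  obtain ⟨n, -, hn⟩ := hω
  have hev : ∀ M : ℕ, ∃ i : ℕ, ∀ m : ℤ, |m| ≤ M → v (m + (n i : ℤ)) = ω m := by
    intro M
    have h1 : ∀ᶠ i in atTop, ∀ m ∈ Finset.Icc (-(M : ℤ)) M, v (m + (n i : ℤ)) = ω m :=
      (Filter.eventually_all_finset _).2 fun m _ => hn m
    obtain ⟨i, hi⟩ := h1.exists
    exact ⟨i, fun m hm => hi m (Finset.mem_Icc.2 (abs_le.1 hm))⟩
  ext E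
  constructor
  · refine spectrum_subset_of_patterns hHω hHv (fun L => ?_) E
    obtain ⟨i, hi⟩ := hev L
    exact ⟨n i, hi⟩
  · refine spectrum_subset_of_patterns hHv hHω (fun L => ?_) E
    obtain ⟨N, hN⟩ := uniform_recurrence v α β hα hv L
    obtain ⟨i, hi⟩ := hev (L + N)
    obtain ⟨j, hj, hjm⟩ := hN (n i)
    refine ⟨j, fun m hm => ?_⟩
    rw [← hi (m + j) (by push_cast; exact (abs_add_le m j).trans (add_le_add hm hj)),
      ← hjm m hm]
    congr 1
    ring
end

section
/- Let v be a primitive invertible two-letter substitution sequence, let 𝔭 ∈ ℝ∖{0} and 𝔮 ∈ ℝ with (𝔭,𝔮) ≠ (1,0). Then for every ω in the hull Ω_v, the operator H_{ω,(𝔭,𝔮)} has empty point spectrum: there is no E ∈ ℂ and nonzero φ ∈ ℓ²(ℤ,ℂ) with H_{ω,(𝔭,𝔮)}φ = Eφ. -/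
open Filter Topology

namespace SturmJacobi

open Matrix

abbrev Mat2 : Type := Matrix (Fin 2) (Fin 2) ℝ

/-- Transfer matrix from position `j` over `n` letters. -/
def T (A : Bool → Mat2) (v : ℤ → Bool) (j : ℤ) : ℕ → Mat2
  | 0 => 1
  | n + 1 => A (v (j + n)) * T A v j n

lemma T_add (A : Bool → Mat2) (v : ℤ → Bool) (j : ℤ) (m n : ℕ) :
    T A v j (m + n) = T A v (j + m) n * T A v j m := by
  induction n with
  | zero => simp [T]
  | succ n ih =>
    rw [← add_assoc, T, ih, T, mul_assoc]
    congr 3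
    push_cast; ring_nf

lemma T_one (A : Bool → Mat2) (v : ℤ → Bool) (j : ℤ) : T A v j 1 = A (v j) := by
  simp [T]

lemma T_det (A : Bool → Mat2) (hA : ∀ b, (A b).det = 1) (v : ℤ → Bool) (j : ℤ) (n : ℕ) :
    (T A v j n).det = 1 := by
  induction n with
  | zero => simp [T]
  | succ n ih => rw [T, Matrix.det_mul, ih, hA, one_mul]

lemma T_congr (A : Bool → Mat2) (v : ℤ → Bool) (j j' : ℤ) (n : ℕ)
    (h : ∀ i : ℕ, i < n → v (j + i) = v (j' + i)) : T A v j n = T A v j' n := by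
  induction n with
  | zero => simp [T]
  | succ n ih =>
    rw [T, T, ih (fun i hi => h i (by omega)), h n (by omega)]

lemma trace_slide (A : Bool → Mat2) (hA : ∀ b, (A b).det = 1) (v : ℤ → Bool) (j : ℤ) (p : ℕ)
    (h : v (j + p) = v j) : (T A v (j + 1) p).trace = (T A v j p).trace := by
  have h1 : T A v j (p + 1) = A (v j) * T A v j p := by rw [T, h]
  have h2 : T A v j (1 + p) = T A v (j + 1) p * A (v j) := by
    rw [T_add, T_one]; simp
  rw [add_comm 1 p, h1] at h2
  have hu : IsUnit (A (v j)).det := by rw [hA]; exact isUnit_one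
  have h3 : T A v (j + 1) p = A (v j) * T A v j p * (A (v j))⁻¹ := by
    rw [h2, Matrix.mul_assoc, Matrix.mul_nonsing_inv _ hu, Matrix.mul_one]
  rw [h3, Matrix.mul_assoc, Matrix.trace_mul_comm, Matrix.mul_assoc, Matrix.nonsing_inv_mul _ hu,
    Matrix.mul_one]

lemma trace_slide_many (A : Bool → Mat2) (hA : ∀ b, (A b).det = 1) (v : ℤ → Bool) (j : ℤ) (p : ℕ)
    (n : ℕ) (h : ∀ i : ℕ, i < n → v (j + i + p) = v (j + i)) :
    (T A v (j + n) p).trace = (T A v j p).trace := by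
  induction n with
  | zero => simp
  | succ n ih =>
    rw [← ih (fun i hi => h i (by omega)), ← trace_slide A hA v (j + n) p (h n (by omega))]
    push_cast; ring_nf

lemma sol (A : Bool → Mat2) (v : ℤ → Bool) (X : ℤ → Fin 2 → ℝ) (j : ℤ) (n : ℕ)
    (h : ∀ i : ℤ, j ≤ i → i < j + n → X (i + 1) = A (v i) *ᵥ X i) :
    X (j + n) = T A v j n *ᵥ X j := by
  induction n with
  | zero => simp [T]
  | succ n ih =>
    have := ih (fun i h1 h2 => h i h1 (by push_cast; omega))
    have h3 := h (j + n) (by omega) (by push_cast; omega)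
    rw [T, ← Matrix.mulVec_mulVec, ← this, ← h3]
    push_cast; ring_nf

lemma cayley (M : Mat2) (h : M.det = 1) : M * M = M.trace • M - 1 := by
  rw [Matrix.det_fin_two] at h
  ext a b
  fin_cases a <;> fin_cases b <;>
    simp [Matrix.mul_apply, Fin.sum_univ_two, Matrix.trace_fin_two] <;> linarith

lemma sq (A : Bool → Mat2) (hA : ∀ b, (A b).det = 1) (v : ℤ → Bool) (X : ℤ → Fin 2 → ℝ)
    (j : ℤ) (p : ℕ)
    (h : ∀ i : ℤ, j ≤ i → i < j + 2 * p → X (i + 1) = A (v i) *ᵥ X i)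
    (hp : ∀ i : ℕ, i < p → v (j + i) = v (j + p + i)) :
    X j + X (j + 2 * p) = (T A v j p).trace • X (j + p) := by
  have e1 := sol A v X j p (fun i h1 h2 => h i h1 (by omega))
  have e2 := sol A v X (j + p) p (fun i h1 h2 => h i (by omega) (by omega))
  rw [← T_congr A v j (j + p) p hp, e1, Matrix.mulVec_mulVec, cayley _ (T_det A hA v j p)] at e2
  have : j + 2 * (p : ℤ) = j + p + p := by ring
  rw [this, e2, e1, Matrix.sub_mulVec, Matrix.one_mulVec, Matrix.smul_mulVec]
  abel

/-- Square relation, with the trace evaluated at another point of the periodic run. -/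
lemma sq' (A : Bool → Mat2) (hA : ∀ b, (A b).det = 1) (v : ℤ → Bool) (X : ℤ → Fin 2 → ℝ)
    (j k m : ℤ) (p : ℕ)
    (h : ∀ i : ℤ, j ≤ i → i < j + 2 * p → X (i + 1) = A (v i) *ᵥ X i)
    (hag : ∀ i : ℤ, 1 ≤ i → i ≤ m → v (k - i) = v (k + p - i))
    (h1 : k - m ≤ j) (h2 : j + p ≤ k) :
    X j + X (j + 2 * p) = (T A v k p).trace • X (j + p) := by
  have hp : ∀ i : ℕ, (i : ℤ) < k - j → v (j + i + p) = v (j + i) := by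
    intro i hi
    have := hag (k - j - i) (by omega) (by omega)
    rw [show k - (k - j - i) = j + i by ring, show k + p - (k - j - i) = j + i + p by ring] at this
    exact this.symm
  rw [sq A hA v X j p h (fun i hi => by rw [← hp i (by omega)]; ring_nf)]
  obtain ⟨n, hn⟩ : ∃ n : ℕ, k = j + n := ⟨(k - j).toNat, by omega⟩
  rw [hn, trace_slide_many A hA v j p n (fun i hi => hp i (by omega))]

/-- A locally decaying solution around `N`. -/
structure Ctx (A : Bool → Mat2) (v : ℤ → Bool) (X : ℤ → Fin 2 → ℝ) (N R L0 : ℤ) (η : ℝ) :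
    Prop where
  rec_eq : ∀ i : ℤ, N - R ≤ i → i < N + R → X (i + 1) = A (v i) *ᵥ X i
  dec : ∀ j : ℤ, L0 ≤ |j - N| → |j - N| ≤ R → ‖X j‖ ≤ η * ‖X N‖
  ne : X N ≠ 0
  pos : 0 < η
  L0pos : 0 < L0

section facts
variable {A : Bool → Mat2} {v : ℤ → Bool} {X : ℤ → Fin 2 → ℝ} {N R L0 : ℤ} {η : ℝ}

lemma Ctx.decl (c : Ctx A v X N R L0 η) (j : ℤ) (h1 : j ≤ N - L0) (h2 : N - R ≤ j) :
    ‖X j‖ ≤ η * ‖X N‖ := by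
  have := c.L0pos
  have : |j - N| = N - j := by rw [abs_of_neg (by omega)]; ring
  exact c.dec j (by omega) (by omega)

lemma Ctx.decr (c : Ctx A v X N R L0 η) (j : ℤ) (h1 : N + L0 ≤ j) (h2 : j ≤ N + R) :
    ‖X j‖ ≤ η * ‖X N‖ := by
  have := c.L0pos
  have : |j - N| = j - N := by rw [abs_of_pos (by omega)]
  exact c.dec j (by omega) (by omega)

lemma Ctx.ctr (c : Ctx A v X N R L0 η) (hA : ∀ b, (A b).det = 1) (k m : ℤ) (p : ℕ)
    (hp : L0 ≤ p) (hR : 2 * (p : ℤ) ≤ R)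
    (hag : ∀ i : ℤ, 1 ≤ i → i ≤ m → v (k - i) = v (k + p - i))
    (h1 : k - m ≤ N - p) (h2 : N ≤ k) : |(T A v k p).trace| ≤ 2 * η := by
  have h := sq' A hA v X (N - p) k m p
    (fun i a b => c.rec_eq i (by omega) (by omega)) hag h1 (by omega)
  have e1 := c.decl (N - p) (by omega) (by omega)
  have e2 := c.decr (N - p + 2 * p) (by omega) (by omega)
  rw [sub_add_cancel] at h
  have h3 := norm_add_le (X (N - p)) (X (N - p + 2 * p))
  rw [h, norm_smul, Real.norm_eq_abs] at h3
  have hX : 0 < ‖X N‖ := norm_pos_iff.2 c.ne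
  have : |(T A v k p).trace| * ‖X N‖ ≤ (2 * η) * ‖X N‖ := by linarith
  exact le_of_mul_le_mul_right this hX

lemma Ctx.rgt (c : Ctx A v X N R L0 η) (hA : ∀ b, (A b).det = 1) (k m : ℤ) (p : ℕ)
    (hp : L0 ≤ p) (hR : 2 * (p : ℤ) ≤ R)
    (hag : ∀ i : ℤ, 1 ≤ i → i ≤ m → v (k - i) = v (k + p - i))
    (h1 : k - m ≤ N) (h2 : N + p ≤ k) : 1 ≤ (|(T A v k p).trace| + 1) * η := by
  have h := sq' A hA v X N k m p
    (fun i a b => c.rec_eq i (by omega) (by omega)) hag h1 (by omega)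
  have e1 := c.decr (N + p) (by omega) (by omega)
  have e2 := c.decr (N + 2 * p) (by omega) (by omega)
  have h' : X N = (T A v k p).trace • X (N + p) - X (N + 2 * p) := by rw [← h]; abel
  have h3 := norm_sub_le ((T A v k p).trace • X (N + p)) (X (N + 2 * p))
  rw [← h', norm_smul, Real.norm_eq_abs] at h3
  have hX : 0 < ‖X N‖ := norm_pos_iff.2 c.ne
  have h4 := mul_le_mul_of_nonneg_left e1 (abs_nonneg (T A v k p).trace)
  have : 1 * ‖X N‖ ≤ ((|(T A v k p).trace| + 1) * η) * ‖X N‖ := by linarith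
  exact le_of_mul_le_mul_right this hX

lemma Ctx.lft (c : Ctx A v X N R L0 η) (hA : ∀ b, (A b).det = 1) (k m : ℤ) (p : ℕ)
    (hp : L0 ≤ p) (hR : 2 * (p : ℤ) ≤ R)
    (hag : ∀ i : ℤ, 1 ≤ i → i ≤ m → v (k - i) = v (k + p - i))
    (h1 : k - m ≤ N - 2 * p) (h2 : N - p ≤ k) : 1 ≤ (|(T A v k p).trace| + 1) * η := by
  have h := sq' A hA v X (N - 2 * p) k m p
    (fun i a b => c.rec_eq i (by omega) (by omega)) hag h1 (by omega)
  have e1 := c.decl (N - 2 * p + p) (by omega) (by omega)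
  have e2 := c.decl (N - 2 * p) (by omega) (by omega)
  rw [sub_add_cancel] at h
  have h' : X N = (T A v k p).trace • X (N - 2 * p + p) - X (N - 2 * p) := by rw [← h]; abel
  have h3 := norm_sub_le ((T A v k p).trace • X (N - 2 * p + p)) (X (N - 2 * p))
  rw [← h', norm_smul, Real.norm_eq_abs] at h3
  have hX : 0 < ‖X N‖ := norm_pos_iff.2 c.ne
  have h4 := mul_le_mul_of_nonneg_left e1 (abs_nonneg (T A v k p).trace)
  have : 1 * ‖X N‖ ≤ ((|(T A v k p).trace| + 1) * η) * ‖X N‖ := by linarith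
  exact le_of_mul_le_mul_right this hX

end facts

/-- One level of the hierarchical block decomposition of the rotation sequence `v`. -/
structure Level (A : Bool → Mat2) (v : ℤ → Bool) (x : ℤ → ℝ) (α D : ℝ) where
  B : ℤ → Prop
  τ : ℤ → Bool
  π : ℤ → Bool
  l : Bool → ℕ
  M : Bool → Mat2
  δ : Bool → ℝ
  lpos : ∀ b, 1 ≤ l b
  next : ∀ k, B k → B (k + l (τ k)) ∧ π (k + l (τ k)) = τ k
  prev : ∀ k, B k → B (k - l (π k)) ∧ τ (k - l (π k)) = π k
  same : ∀ k k', B k → B k' → τ k = τ k' → ∀ i : ℤ, 0 ≤ i → i < l (τ k) → v (k + i) = v (k' + i)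
  mat : ∀ k, B k → T A v k (l (τ k)) = M (τ k)
  cover : ∀ K, ∃ k, B k ∧ k ≤ K ∧ K < k + l (τ k)
  sa : ∀ k k', B k → B k' → ∀ i : ℤ, 1 ≤ i → i ≤ (l false : ℤ) + l true - 2 → v (k - i) = v (k' - i)
  det : ∀ b, (M b).det = 1
  hD : (M false).trace ^ 2 + (M true).trace ^ 2 + (M false * M true).trace ^ 2
    - (M false).trace * (M true).trace * (M false * M true).trace = D
  hne : ¬ ((M false).trace = 0 ∧ (M true).trace = 0 ∧ (M false * M true).trace = 0)
  δpos : ∀ b, 0 < δ b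
  rng : ∀ k, B k → -δ true ≤ x k ∧ x k < δ false
  τx : ∀ k, B k → (τ k = true ↔ 0 ≤ x k)
  πx : ∀ k, B k → (π k = true ↔ x k < δ false - δ true)
  stepF : ∀ k, B k → τ k = false → x (k + l false) = x k + δ false
  stepT : ∀ k, B k → τ k = true → x (k + l true) = x k - δ true
  zF : ∃ z : ℤ, δ false = l false * α + z
  zT : ∃ z : ℤ, δ true = -(l true * α) + z

lemma trace_three (P Q : Mat2) (hQ : Q.det = 1) :
    (Q * P * Q).trace = (P * Q).trace * Q.trace - P.trace := by
  rw [Matrix.mul_assoc, Matrix.trace_mul_comm, Matrix.mul_assoc, cayley Q hQ, mul_sub,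
    Matrix.trace_sub, mul_one, Matrix.mul_smul, Matrix.trace_smul, smul_eq_mul]
  ring

namespace Level
variable {A : Bool → Mat2} {v : ℤ → Bool} {x : ℤ → ℝ} {α D : ℝ}

lemma iso (L : Level A v x α D) (i : Bool) (h : L.δ (!i) < L.δ i) (k : ℤ) (hk : L.B k)
    (hi : L.τ k = i) : L.τ (k + L.l i) = !i := by
  have hn := (L.next k hk).1
  rw [hi] at hn
  have r := L.rng k hk
  cases i with
  | false =>
    simp only [Bool.not_false] at *
    rw [L.τx _ hn, L.stepF k hk hi]
    linarith
  | true =>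
    simp only [Bool.not_true] at *
    rw [← Bool.not_eq_true, L.τx _ hn, L.stepT k hk hi]
    linarith

lemma iso_pi (L : Level A v x α D) (i : Bool) (h : L.δ (!i) < L.δ i) (k : ℤ) (hk : L.B k)
    (hi : L.τ k = i) : L.π k = !i := by
  by_contra hc
  have hc' : L.π k = i := by cases i <;> simp_all
  obtain ⟨h1, h2⟩ := L.prev k hk
  rw [hc'] at h1 h2
  have := L.iso i h _ h1 h2
  rw [sub_add_cancel, hi] at this
  cases i <;> simp at this

lemma sa' (L : Level A v x α D) (b : Bool) (k k' : ℤ) (hk : L.B k) (hk' : L.B k')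
    (i : ℤ) (h1 : 1 ≤ i) (h2 : i ≤ (L.l b : ℤ) + L.l (!b) - 2) : v (k - i) = v (k' - i) := by
  apply L.sa k k' hk hk' i h1
  cases b <;> simp at h2 <;> omega

/-- Agreement to the left extended by a common block. -/
lemma sa_ext (L : Level A v x α D) (b : Bool) (k k' m : ℤ) (hk : L.B k) (hk' : L.B k')
    (hb : L.τ k = b) (hb' : L.τ k' = b)
    (h : ∀ i : ℤ, 1 ≤ i → i ≤ m → v (k - i) = v (k' - i))
    (i : ℤ) (h1 : 1 ≤ i) (h2 : i ≤ L.l b + m) :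
    v (k + L.l b - i) = v (k' + L.l b - i) := by
  by_cases hi : i ≤ L.l b
  · have := L.same k k' hk hk' (by rw [hb, hb']) (L.l b - i) (by omega) (by rw [hb]; omega)
    rw [show k + (L.l b : ℤ) - i = k + (L.l b - i) by ring, this]
    ring_nf
  · have := h (i - L.l b) (by omega) (by omega)
    rw [show k + (L.l b : ℤ) - i = k - (i - L.l b) by ring, this]
    ring_nf

lemma trace_z (L : Level A v x α D) (i : Bool) :
    (L.M (!i) * L.M i).trace = (L.M false * L.M true).trace := by
  cases i
  · simp [Matrix.trace_mul_comm (L.M true)]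
  · simp

lemma hD' (L : Level A v x α D) (i : Bool) : (L.M i).trace ^ 2 + (L.M (!i)).trace ^ 2 +
    (L.M false * L.M true).trace ^ 2
    - (L.M i).trace * (L.M (!i)).trace * (L.M false * L.M true).trace = D := by
  have := L.hD
  cases i
  · simpa using this
  · simp; linarith

lemma hne' (L : Level A v x α D) (i : Bool) :
    ¬ ((L.M i).trace = 0 ∧ (L.M (!i)).trace = 0 ∧ (L.M false * L.M true).trace = 0) := by
  have := L.hne
  cases i
  · simpa using this
  · simp at this ⊢; tauto

/-- new matrices -/
def M' (L : Level A v x α D) (i b : Bool) : Mat2 := if b = i then L.M (!i) * L.M i else L.M b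
/-- new lengths -/
def l' (L : Level A v x α D) (i b : Bool) : ℕ := if b = i then L.l i + L.l (!i) else L.l b
/-- new interval lengths -/
def δ' (L : Level A v x α D) (i b : Bool) : ℝ := if b = i then L.δ i - L.δ (!i) else L.δ b

lemma M'_i (L : Level A v x α D) (i : Bool) : L.M' i i = L.M (!i) * L.M i := by simp [M']
lemma M'_o (L : Level A v x α D) (i : Bool) : L.M' i (!i) = L.M (!i) := by simp [M']
lemma l'_i (L : Level A v x α D) (i : Bool) : L.l' i i = L.l i + L.l (!i) := by simp [l']
lemma l'_o (L : Level A v x α D) (i : Bool) : L.l' i (!i) = L.l (!i) := by simp [l']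
lemma l'_sum (L : Level A v x α D) (i : Bool) :
    L.l' i false + L.l' i true = L.l i + L.l (!i) + L.l (!i) := by
  cases i <;> simp [l'] ; omega
lemma l'_ge (L : Level A v x α D) (i b : Bool) : L.l b ≤ L.l' i b := by
  unfold l'; split_ifs with h
  · rw [h]; omega
  · rfl

lemma M'_z (L : Level A v x α D) (i : Bool) : (L.M' i false * L.M' i true).trace =
    (L.M false * L.M true).trace * (L.M (!i)).trace - (L.M i).trace := by
  cases i
  · simp [M']
    rw [trace_three _ _ (L.det _)]
  · simp [M']
    rw [Matrix.trace_mul_comm, trace_three _ _ (L.det _), Matrix.trace_mul_comm (L.M true)]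

lemma bool_cases (i b : Bool) : b = i ∨ b = !i := by cases i <;> cases b <;> simp

/-- The next level, where the isolated type `i` is merged with its successor. -/
def step (L : Level A v x α D) (i : Bool) (h : L.δ (!i) < L.δ i) : Level A v x α D where
  B k := L.B k ∧ L.π k = !i
  τ := L.τ
  π k := L.π (k - L.l (!i))
  l := L.l' i
  M := L.M' i
  δ := L.δ' i
  lpos b := (L.lpos b).trans (L.l'_ge i b)
  next := by
    rintro k ⟨hk, hp⟩
    rcases bool_cases i (L.τ k) with hb | hb
    · rw [hb, l'_i]
      have h1 := L.next k hk
      rw [hb] at h1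
      have h2 := L.iso i h k hk hb
      have h3 := L.next _ h1.1
      rw [h2] at h3
      push_cast
      rw [← add_assoc]
      refine ⟨h3, ?_⟩
      rw [add_sub_cancel_right, h1.2]
    · rw [hb, l'_o]
      have h1 := L.next k hk
      rw [hb] at h1
      exact ⟨h1, by rw [add_sub_cancel_right, hp]⟩
  prev := by
    rintro k ⟨hk, hp⟩
    have h1 := L.prev k hk
    rw [hp] at h1
    rcases bool_cases i (L.π (k - L.l (!i))) with hb | hb
    · rw [hb, l'_i]
      have h2 := L.prev _ h1.1
      rw [hb] at h2
      have h3 := L.iso_pi i h _ h2.1 h2.2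
      rw [show k - ((L.l i + L.l (!i) : ℕ) : ℤ) = k - L.l (!i) - L.l i by push_cast; ring]
      exact ⟨⟨h2.1, h3⟩, h2.2⟩
    · rw [hb, l'_o]
      exact ⟨⟨h1.1, hb⟩, h1.2⟩
  same := by
    rintro k k' ⟨hk, hp⟩ ⟨hk', hp'⟩ he j h0 h1
    rcases bool_cases i (L.τ k) with hb | hb
    · rw [hb, l'_i] at h1
      by_cases hj : j < L.l i
      · exact L.same k k' hk hk' he j h0 (by rw [hb]; exact hj)
      · have a1 := L.next k hk
        have a2 := L.next k' hk'
        rw [← he] at a2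
        rw [hb] at a1 a2 he
        have b1 := L.iso i h k hk hb
        have b2 := L.iso i h k' hk' he.symm
        have := L.same _ _ a1.1 a2.1 (by rw [b1, b2]) (j - L.l i) (by omega)
          (by rw [b1]; push_cast at h1; omega)
        rw [show k + j = k + L.l i + (j - L.l i) by ring, this]
        ring_nf
    · rw [hb, l'_o] at h1
      exact L.same k k' hk hk' he j h0 (by rw [hb]; exact h1)
  mat := by
    rintro k ⟨hk, hp⟩
    rcases bool_cases i (L.τ k) with hb | hb
    · have a0 := L.mat k hk
      have a1 := L.next k hk
      rw [hb] at a1 a0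
      have a2 := L.mat _ a1.1
      rw [L.iso i h k hk hb] at a2
      rw [hb, l'_i, M'_i, T_add, a0, a2]
    · have a0 := L.mat k hk
      rw [hb] at a0
      rw [hb, l'_o, M'_o, a0]
  cover := by
    intro K
    obtain ⟨k, hk, h1, h2⟩ := L.cover K
    rcases bool_cases i (L.π k) with hb | hb
    · have a1 := L.prev k hk
      rw [hb] at a1
      refine ⟨k - L.l i, ⟨a1.1, L.iso_pi i h _ a1.1 a1.2⟩, by omega, ?_⟩
      have a2 := L.iso i h _ a1.1 a1.2
      rw [sub_add_cancel] at a2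
      rw [a1.2, l'_i]
      rw [a2] at h2
      push_cast; omega
    · refine ⟨k, ⟨hk, hb⟩, h1, lt_of_lt_of_le h2 ?_⟩
      have := L.l'_ge i (L.τ k)
      omega
  sa := by
    rintro k k' ⟨hk, hp⟩ ⟨hk', hp'⟩ j h0 h1
    have hs := L.l'_sum i
    have a1 := L.prev k hk
    have a2 := L.prev k' hk'
    rw [hp] at a1
    rw [hp'] at a2
    have := L.sa_ext (!i) _ _ ((L.l i : ℤ) + L.l (!i) - 2) a1.1 a2.1 a1.2 a2.2
      (fun j h0 h1 => L.sa' i _ _ a1.1 a2.1 j h0 h1) j h0 (by omega)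
    rwa [sub_add_cancel, sub_add_cancel] at this
  det b := by
    unfold M'; split_ifs
    · rw [Matrix.det_mul, L.det, L.det, one_mul]
    · exact L.det b
  hD := by
    have e := L.hD' i
    have z := L.M'_z i
    have hz := L.trace_z i
    have : (L.M' i false).trace ^ 2 + (L.M' i true).trace ^ 2 =
      (L.M' i i).trace ^ 2 + (L.M' i (!i)).trace ^ 2 := by cases i <;> simp; ring
    rw [this]
    have : (L.M' i false).trace * (L.M' i true).trace =
      (L.M' i i).trace * (L.M' i (!i)).trace := by cases i <;> simp; ring
    rw [this, z, M'_i, M'_o, hz]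
    linear_combination e
  hne := by
    have e := L.hne' i
    have z := L.M'_z i
    have hz := L.trace_z i
    rintro ⟨h1, h2, h3⟩
    have a1 : (L.M' i i).trace = 0 := by cases i <;> assumption
    have a2 : (L.M' i (!i)).trace = 0 := by cases i <;> assumption
    rw [M'_i, hz] at a1
    rw [M'_o] at a2
    rw [z, a1, a2] at h3
    exact e ⟨by linarith, a2, a1⟩
  δpos b := by
    unfold δ'; split_ifs
    · linarith
    · exact L.δpos b
  rng := by
    rintro k ⟨hk, hp⟩
    have r := L.rng k hk
    have p := L.πx k hk
    cases i
    · simp [δ'] at *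
      rw [hp] at p
      simp at p
      constructor <;> linarith
    · simp [δ'] at *
      rw [hp] at p
      simp at p
      constructor <;> linarith
  τx k hk := L.τx k hk.1
  πx := by
    rintro k ⟨hk, hp⟩
    have a1 := L.prev k hk
    rw [hp] at a1
    have p := L.πx _ a1.1
    cases i
    · have s := L.stepT _ a1.1 a1.2
      simp [δ'] at *
      rw [p]
      constructor <;> intro <;> linarith
    · have s := L.stepF _ a1.1 a1.2
      simp [δ'] at *
      rw [p]
      constructor <;> intro <;> linarith
  stepF := by
    rintro k ⟨hk, hp⟩ ht
    cases i
    · have a1 := L.next k hk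
      rw [ht] at a1
      have := L.stepT _ a1.1 (L.iso false h k hk ht)
      simp [l', δ']
      rw [← add_assoc, this, L.stepF k hk ht]; ring
    · simpa [l', δ'] using L.stepF k hk ht
  stepT := by
    rintro k ⟨hk, hp⟩ ht
    cases i
    · simpa [l', δ'] using L.stepT k hk ht
    · have a1 := L.next k hk
      rw [ht] at a1
      have := L.stepF _ a1.1 (L.iso true h k hk ht)
      simp [l', δ']
      rw [← add_assoc, this, L.stepT k hk ht]; ring
  zF := by
    obtain ⟨a, ha⟩ := L.zF
    obtain ⟨b, hb⟩ := L.zT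
    cases i
    · refine ⟨a - b, ?_⟩
      simp [l', δ']
      rw [ha, hb]; ring
    · exact ⟨a, by simpa [l', δ'] using ha⟩
  zT := by
    obtain ⟨a, ha⟩ := L.zF
    obtain ⟨b, hb⟩ := L.zT
    cases i
    · exact ⟨b, by simpa [l', δ'] using hb⟩
    · refine ⟨b - a, ?_⟩
      simp [l', δ']
      rw [ha, hb]; ring

lemma M_step (L : Level A v x α D) (i : Bool) (h : L.δ (!i) < L.δ i) : (L.step i h).M = L.M' i := rfl
lemma l_step (L : Level A v x α D) (i : Bool) (h : L.δ (!i) < L.δ i) : (L.step i h).l = L.l' i := rfl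
lemma τ_step (L : Level A v x α D) (i : Bool) (h : L.δ (!i) < L.δ i) : (L.step i h).τ = L.τ := rfl

lemma δ_ne (L : Level A v x α D) (hα : Irrational α) : L.δ false ≠ L.δ true := by
  intro h
  obtain ⟨a, ha⟩ := L.zF
  obtain ⟨b, hb⟩ := L.zT
  rw [ha, hb] at h
  have h1 : ((L.l false + L.l true : ℕ) : ℝ) * α = ((b - a : ℤ) : ℝ) := by
    push_cast; linarith
  have hl : L.l false + L.l true ≠ 0 := by have := L.lpos false; omega
  have := hα.natCast_mul hl
  rw [h1] at this
  exact this.ne_int _ rfl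

lemma exists_iso (L : Level A v x α D) (hα : Irrational α) : ∃ i, L.δ (!i) < L.δ i := by
  rcases lt_or_gt_of_ne (L.δ_ne hα) with h | h
  · exact ⟨true, by simpa using h⟩
  · exact ⟨false, by simpa using h⟩

section pos
variable {X : ℤ → Fin 2 → ℝ} {N R L0 : ℤ} {η : ℝ}

/-- position of `N` in a block starting at `k` -/
structure At (L : Level A v x α D) (N R L0 k : ℤ) : Prop where
  hB : L.B k
  lo : k + 2 ≤ N
  hi : N ≤ k + L.l (L.τ k)
  hR : 4 * ((L.l false : ℤ) + L.l true) ≤ R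
  hl : ∀ b, L0 ≤ L.l b

lemma sum_eq (L : Level A v x α D) (b : Bool) :
    (L.l false : ℤ) + L.l true = L.l b + L.l (!b) := by
  cases b <;> simp ; omega

/-- smallness of the parameter -/
structure Par (D η : ℝ) : Prop where
  pos : 0 < η
  h1 : 0 < D → 2 * η * (D + 2) ≤ 1 / 4
  h2 : 0 < D → 4 * (2 * η * (D + 2)) ^ 2 < D
  h3 : 2 * η ≤ 1

lemma quad_bound (a b c D : ℝ) (h : a ^ 2 + b ^ 2 + c ^ 2 - a * b * c = D) (ha : |a| ≤ 1)
    (hne : ¬ (a = 0 ∧ b = 0 ∧ c = 0)) : 0 < D ∧ |b| ≤ D + 1 ∧ |c| ≤ D + 1 := by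
  obtain ⟨h1, h2⟩ := abs_le.1 ha
  have key : (b ^ 2 + c ^ 2) / 2 + a ^ 2 ≤ D := by
    nlinarith [mul_nonneg (by linarith : (0:ℝ) ≤ 1 + a) (sq_nonneg (b + c)),
      mul_nonneg (by linarith : (0:ℝ) ≤ 1 - a) (sq_nonneg (b - c)), sq_nonneg (b - c), sq_nonneg (b + c)]
  have hD0 : 0 < D := by
    by_contra hc
    apply hne
    have := sq_nonneg a; have := sq_nonneg b; have := sq_nonneg c
    refine ⟨?_, ?_, ?_⟩ <;> apply pow_eq_zero_iff (two_ne_zero) |>.1 <;> linarith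
  refine ⟨hD0, ?_, ?_⟩ <;> apply abs_le_of_sq_le_sq _ (by linarith) <;>
    nlinarith [sq_nonneg a, sq_nonneg b, sq_nonneg c, sq_nonneg D]


lemma At.F1 (hA : ∀ b, (A b).det = 1) {L : Level A v x α D} {k : ℤ} (p : L.At N R L0 k) (c : Ctx A v X N R L0 η) :
    |(L.M (L.τ (k + L.l (L.τ k)))).trace| ≤ 2 * η := by
  obtain ⟨hB, lo, hi, hR, hl⟩ := p
  obtain ⟨n1, n2⟩ := L.next k hB
  obtain ⟨m1, m2⟩ := L.next _ n1
  have hm := L.mat _ n1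
  have hs := L.sum_eq (L.τ k)
  rcases bool_cases (L.τ k) (L.τ (k + L.l (L.τ k))) with hd | hd
  · rw [hd] at hm m1 ⊢
    rw [← hm]
    have := hl (L.τ k)
    refine c.ctr hA (k + L.l (L.τ k)) (L.l (L.τ k) + ((L.l (L.τ k) : ℤ) + L.l (! (L.τ k)) - 2)) _
      this (by omega) ?_ (by have := L.lpos (!(L.τ k)); omega) (by omega)
    exact fun i h1 h2 => L.sa_ext (L.τ k) k (k + L.l (L.τ k)) _ hB n1 rfl hd
        (fun j h1 h2 => L.sa' (L.τ k) _ _ hB n1 j h1 h2) i h1 h2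
  · rw [hd] at hm m1 ⊢
    rw [← hm]
    have := hl (!L.τ k)
    refine c.ctr hA (k + L.l (L.τ k)) ((L.l (L.τ k) : ℤ) + L.l (! (L.τ k)) - 2) _
      this (by omega) ?_ (by omega) (by omega)
    exact fun i h1 h2 => L.sa' (L.τ k) _ _ n1 m1 i h1 h2

lemma At.bdd (hA : ∀ b, (A b).det = 1) {L : Level A v x α D} {k : ℤ} (p : L.At N R L0 k) (c : Ctx A v X N R L0 η)
    (q : Par D η) : 0 < D ∧ ∀ b, |(L.M b).trace| ≤ D + 1 := by
  have h := p.F1 hA c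
  set d := L.τ (k + L.l (L.τ k)) with hd
  have h3 := q.h3
  have e := L.hD' d
  obtain ⟨h0, h1, h2⟩ := quad_bound _ _ _ D e (by linarith) (L.hne' d)
  refine ⟨h0, fun b => ?_⟩
  rcases bool_cases d b with hb | hb
  · rw [hb]; linarith
  · rw [hb]; exact h1

lemma At.notlarge (hA : ∀ b, (A b).det = 1) {L : Level A v x α D} {k : ℤ} (p : L.At N R L0 k) (c : Ctx A v X N R L0 η)
    (q : Par D η) (b : Bool) (h : 1 ≤ (|(L.M b).trace| + 1) * η) : False := by
  obtain ⟨h0, h1⟩ := p.bdd hA c q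
  have := h1 b
  have h2 := q.h1 h0
  have h3 := q.pos
  nlinarith

/-- the two blocks after the block of `N` are different -/
lemma At.F2 (hA : ∀ b, (A b).det = 1) {L : Level A v x α D} {k : ℤ} (p : L.At N R L0 k) (c : Ctx A v X N R L0 η)
    (q : Par D η) (d : Bool) (hd : L.τ (k + L.l (L.τ k)) = d) :
    L.τ (k + L.l (L.τ k) + L.l d) = !d := by
  rcases bool_cases d (L.τ (k + L.l (L.τ k) + L.l d)) with hd' | hd'
  swap
  · exact hd'
  exfalso
  have p' := p
  obtain ⟨hB, lo, hi, hR, hl⟩ := p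
  obtain ⟨n1, n2⟩ := L.next k hB
  obtain ⟨m1, m2⟩ := L.next _ n1
  rw [hd] at m1
  have hm := L.mat _ m1
  have hs := L.sum_eq (L.τ k)
  have hs' := L.sum_eq d
  rw [hd'] at hm
  apply p'.notlarge hA c q d
  rw [← hm]
  have := hl d
  refine c.rgt hA (k + L.l (L.τ k) + L.l d) (L.l d + ((L.l d : ℤ) + L.l (!d) - 2)) _
      this (by omega) ?_ (by omega) (by omega)
  exact fun i h1 h2 => L.sa_ext d _ _ _ n1 m1 hd hd'
        (fun j h1 h2 => L.sa' d _ _ n1 m1 j h1 h2) i h1 h2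

/-- the block before the block of `N` is different -/
lemma At.F3 (hA : ∀ b, (A b).det = 1) {L : Level A v x α D} {k : ℤ} (p : L.At N R L0 k) (c : Ctx A v X N R L0 η)
    (q : Par D η) : L.π k = !(L.τ k) := by
  rcases bool_cases (L.τ k) (L.π k) with hd' | hd'
  swap
  · exact hd'
  exfalso
  have p' := p
  obtain ⟨hB, lo, hi, hR, hl⟩ := p
  obtain ⟨n1, n2⟩ := L.prev k hB
  have hm := L.mat _ hB
  set b := L.τ k with hb
  have hs := L.sum_eq b
  rw [hd'] at n1 n2
  apply p'.notlarge hA c q b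
  rw [← hm]
  have := hl b
  refine c.lft hA k (L.l b + ((L.l b : ℤ) + L.l (!b) - 2)) _
      this (by omega) ?_ (by omega) (by omega)
  intro i h1 h2
  have := L.sa_ext b _ _ _ n1 hB n2 hb.symm
        (fun j h1 h2 => L.sa' b _ _ n1 hB j h1 h2) i h1 h2
  rwa [sub_add_cancel] at this

/-- In the pattern `a [b] a b` the product trace is small. -/
lemma At.F5 (hA : ∀ b, (A b).det = 1) {L : Level A v x α D} {k : ℤ} (p : L.At N R L0 k) (c : Ctx A v X N R L0 η)
    (q : Par D η) (hd : L.τ (k + L.l (L.τ k)) = !(L.τ k)) :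
    |(L.M false * L.M true).trace| ≤ 2 * η := by
  have h2 := p.F2 hA c q _ hd
  have h3 := p.F3 hA c q
  obtain ⟨hB, lo, hi, hR, hl⟩ := p
  obtain ⟨a1, a2⟩ := L.prev k hB
  obtain ⟨n1, n2⟩ := L.next k hB
  obtain ⟨m1, m2⟩ := L.next _ n1
  obtain ⟨r1, r2⟩ := L.next _ m1
  have hm := L.mat _ n1
  have hm' := L.mat _ m1
  set b := L.τ k with hb
  rw [hd] at hm hm' m1 r1
  rw [h2, Bool.not_not] at hm' r1
  rw [h3] at a1 a2
  have hs := L.sum_eq b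
  have ht : T A v (k + L.l b) (L.l (!b) + L.l b) = L.M b * L.M (!b) := by
    rw [T_add, hm, hm']
  have ht' : (T A v (k + L.l b) (L.l (!b) + L.l b)).trace = (L.M false * L.M true).trace := by
    rw [ht, Matrix.trace_mul_comm, L.trace_z]
  rw [← ht']
  have := hl b
  refine c.ctr hA (k + L.l b) (L.l b + (L.l (!b) + ((L.l b : ℤ) + L.l (!b) - 2))) _
      (by push_cast; omega) (by push_cast; omega) ?_ (by push_cast; omega) (by omega)
  intro i h1 h2'
  have hb2 := h2
  rw [Bool.not_not] at hb2
  have := L.sa_ext b k (k + L.l b + L.l (!b)) (L.l (!b) + ((L.l b : ℤ) + L.l (!b) - 2)) hB m1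
    hb.symm hb2 (fun j h1 h2 => by
      have := L.sa_ext (!b) (k - L.l (!b)) (k + L.l b) _ a1 n1 a2 hd
        (fun j h1 h2 => L.sa' b _ _ a1 n1 j h1 h2) j h1 h2
      rwa [sub_add_cancel] at this) i h1 h2'
  rw [this]
  congr 1
  push_cast; ring

/-- In the pattern `a [b] a b`, `N` is not near the start of the block. -/
lemma At.F4 (hA : ∀ b, (A b).det = 1) {L : Level A v x α D} {k : ℤ} (p : L.At N R L0 k) (c : Ctx A v X N R L0 η)
    (q : Par D η) (hd : L.τ (k + L.l (L.τ k)) = !(L.τ k)) (hN : N ≤ k + L.l (!(L.τ k))) :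
    False := by
  have h2 := p.F2 hA c q _ hd
  have p' := p
  obtain ⟨hB, lo, hi, hR, hl⟩ := p
  obtain ⟨n1, n2⟩ := L.next k hB
  obtain ⟨m1, m2⟩ := L.next _ n1
  obtain ⟨r1, r2⟩ := L.next _ m1
  have hm' := L.mat _ m1
  set b := L.τ k with hb
  rw [hd] at hm' m1 r1
  rw [h2, Bool.not_not] at hm' r1
  have hs := L.sum_eq b
  apply p'.notlarge hA c q b
  rw [← hm']
  have := hl b
  exact c.rgt hA (k + L.l b + L.l (!b)) ((L.l b : ℤ) + L.l (!b) - 2) _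
      this (by omega) (fun i h1 h2 => L.sa' b _ _ m1 r1 i h1 h2) (by omega) (by omega)

/-- pattern `a [b] b a` is followed by pattern `a [b] a b` -/
lemma At.stepC (hA : ∀ b, (A b).det = 1) {L : Level A v x α D} {k : ℤ} (p : L.At N R L0 k) (c : Ctx A v X N R L0 η)
    (q : Par D η) (hα : Irrational α) (b : Bool) (hb : L.τ k = b) (hd : L.τ (k + L.l b) = b)
    (hR : 8 * ((L.l false : ℤ) + L.l true) ≤ R) :
    ∃ h : L.δ (!(!b)) < L.δ (!b),
      (L.step (!b) h).At N R L0 (k - L.l (!b)) ∧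
      L.τ (k - L.l (!b)) = !b ∧
      L.τ (k - L.l (!b) + L.l' (!b) (!b)) = b := by
  have h3 := p.F3 hA c q
  obtain ⟨hB, lo, hi, hR', hl⟩ := p
  obtain ⟨a1, a2⟩ := L.prev k hB
  rw [hb] at h3 hi
  rw [h3] at a1 a2
  have h : L.δ (!(!b)) < L.δ (!b) := by
    rw [Bool.not_not]
    obtain ⟨i, hi⟩ := L.exists_iso hα
    rcases bool_cases b i with e | e
    · rw [e] at hi
      have := L.iso b hi k hB hb
      rw [hd] at this
      cases b <;> simp at this
    · rw [e, Bool.not_not] at hi; exact hi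
  have hs := L.sum_eq b
  have hs' := L.l'_sum (!b)
  have h6 := L.l'_i (!b)
  rw [Bool.not_not] at hs' h6
  refine ⟨h, ⟨⟨a1, L.iso_pi _ h _ a1 a2⟩, by omega, ?_, ?_, fun b' => ?_⟩, a2, ?_⟩
  · rw [τ_step, l_step, a2, h6]; push_cast; omega
  · rw [l_step]; omega
  · have := L.l'_ge (!b) b'
    have := hl b'
    rw [l_step]; omega
  · rw [h6]; refine Eq.trans ?_ hd; congr 1; push_cast; ring

/-- pattern `a [b] a b` leads to a contradiction -/
lemma At.contraD (hA : ∀ b, (A b).det = 1) {L : Level A v x α D} {k : ℤ} (p : L.At N R L0 k) (c : Ctx A v X N R L0 η)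
    (q : Par D η) (hα : Irrational α) (hd : L.τ (k + L.l (L.τ k)) = !(L.τ k))
    (hR : 16 * ((L.l false : ℤ) + L.l true) ≤ R) : False := by
  have h1 := p.F1 hA c
  have h2 := p.F2 hA c q _ hd
  have h3 := p.F3 hA c q
  have h5 := p.F5 hA c q hd
  have hbd := p.bdd hA c q
  obtain ⟨hB, lo, hi, hR', hl⟩ := p
  obtain ⟨a1, a2⟩ := L.prev k hB
  obtain ⟨i, hδ⟩ := L.exists_iso hα
  have hs := L.sum_eq i
  have hs' := L.l'_sum i
  have h6 := L.l'_i i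
  have h7 := L.l'_o i
  have hl' : ∀ b, L0 ≤ ((L.step i hδ).l b : ℤ) := fun b => by
    have := L.l'_ge i b
    have := hl b
    rw [l_step]; omega
  rcases bool_cases i (L.τ k) with hb | hb
  · -- the block of `N` is isolated
    rw [hb] at h1 h2 h3 hi hd
    rw [hd] at h1
    have p2 : (L.step i hδ).At N R L0 k :=
      ⟨⟨hB, h3⟩, lo, by rw [τ_step, l_step, hb, h6]; push_cast; omega,
        by rw [l_step]; omega, hl'⟩
    obtain ⟨h', p3, e1, e2⟩ := p2.stepC hA c q hα i hb (by
      rw [τ_step, l_step, h6]; push_cast; rw [← add_assoc, h2, Bool.not_not])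
      (by rw [l_step]; omega)
    rw [τ_step] at e1 e2
    rw [l_step] at e1 e2 p3
    have g6 := (L.step i hδ).l'_i (!i)
    have g7 := (L.step i hδ).l'_o (!i)
    rw [Bool.not_not] at g6 g7
    refine p3.F4 hA c q ?_ ?_
    · rw [τ_step, l_step, τ_step, e1, e2, Bool.not_not]
    · rw [τ_step, l_step, τ_step, e1, Bool.not_not, g7, l_step, h6, h7]
      push_cast; omega
  · -- the block of `N` is not isolated
    rw [hb] at h1 h2 h3 hi hd
    rw [Bool.not_not] at h3 hd
    rw [hd] at h1
    rw [h3] at a1 a2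
    have p2 : (L.step i hδ).At N R L0 (k - L.l i) :=
      ⟨⟨a1, L.iso_pi i hδ _ a1 a2⟩, by omega,
        by rw [τ_step, l_step, a2, h6]; push_cast; omega,
        by rw [l_step]; omega, hl'⟩
    obtain ⟨h', p3, e1, e2⟩ := p2.stepC hA c q hα i a2 (by
      rw [τ_step, l_step, h6]; push_cast
      rw [← hd]; congr 1; rw [hd]; ring)
      (by rw [l_step]; omega)
    rw [τ_step] at e1 e2
    rw [l_step] at e1 e2 p3
    have hd3 : (((L.step i hδ).step (!i) h').τ (k - L.l i - L.l' i (!i) +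
      ((L.step i hδ).step (!i) h').l (((L.step i hδ).step (!i) h').τ (k - L.l i - L.l' i (!i))))) =
      !(((L.step i hδ).step (!i) h').τ (k - L.l i - L.l' i (!i))) := by
      rw [τ_step, l_step, τ_step, e1, e2, Bool.not_not]
    have f5 := p3.F5 hA c q hd3
    have m1 : (L.step i hδ).M' (!i) (!i) = L.M (!i) * L.M i * L.M (!i) := by
      rw [(L.step i hδ).M'_i (!i), Bool.not_not, M_step, L.M'_i i, L.M'_o i]
    have m2 := ((L.step i hδ).M'_o (!i))
    rw [Bool.not_not, M_step, M'_i] at m2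
    have e := ((L.step i hδ).step (!i) h').hD' i
    rw [M_step, m1, m2, L.trace_z] at e
    rw [M_step] at f5
    rw [trace_three _ _ (L.det _)] at e
    have hz : (L.M i * L.M (!i)).trace = (L.M false * L.M true).trace := by
      rw [Matrix.trace_mul_comm, L.trace_z]
    rw [hz] at e
    obtain ⟨D0, hbd⟩ := hbd
    have b1 := hbd (!i)
    have q1 := q.h1 D0
    have q2 := q.h2 D0
    have q3 := q.pos
    generalize (L.M false * L.M true).trace = Z at *
    generalize (L.M (!i)).trace = Y at *
    generalize (L.M i).trace = W at *
    generalize ((L.step i hδ).M' (!i) false * (L.step i hδ).M' (!i) true).trace = V at *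
    have k1 : |Z * Y - W| ≤ 2 * η * (D + 2) := by
      calc |Z * Y - W| ≤ |Z * Y| + |W| := abs_sub _ _
        _ = |Z| * |Y| + |W| := by rw [abs_mul]
        _ ≤ (2 * η) * (D + 1) + 2 * η := by gcongr
        _ = _ := by ring
    have k2 : |Z| ≤ 2 * η * (D + 2) := by nlinarith
    have k3 : |V| ≤ 2 * η * (D + 2) := by nlinarith
    set ε := 2 * η * (D + 2) with hε
    generalize Z * Y - W = U at *
    have s1 : Z ^ 2 ≤ ε ^ 2 := sq_le_sq' (abs_le.1 k2).1 (abs_le.1 k2).2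
    have s2 : U ^ 2 ≤ ε ^ 2 := sq_le_sq' (abs_le.1 k1).1 (abs_le.1 k1).2
    have s3 : V ^ 2 ≤ ε ^ 2 := sq_le_sq' (abs_le.1 k3).1 (abs_le.1 k3).2
    have s4 : |Z * U * V| ≤ ε * ε * 1 := by
      rw [abs_mul, abs_mul]
      have : 0 ≤ ε := (abs_nonneg _).trans k2
      gcongr
      linarith
    have s5 := neg_abs_le (Z * U * V)
    nlinarith

/-- No locally decaying solution. -/
lemma At.contra (hA : ∀ b, (A b).det = 1) {L : Level A v x α D} {k : ℤ} (p : L.At N R L0 k) (c : Ctx A v X N R L0 η)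
    (q : Par D η) (hα : Irrational α) 
    (hR : 32 * ((L.l false : ℤ) + L.l true) ≤ R) : False := by
  rcases bool_cases (L.τ k) (L.τ (k + L.l (L.τ k))) with h | h
  · obtain ⟨h', p1, e1, e2⟩ := p.stepC hA c q hα _ rfl h (by omega)
    have hs := L.sum_eq (L.τ k)
    have hs' := L.l'_sum (!(L.τ k))
    rw [Bool.not_not] at hs'
    refine p1.contraD hA c q hα ?_ ?_
    · rw [τ_step, l_step, e1, e2, Bool.not_not]
    · rw [l_step]; omega
  · exact p.contraD hA c q hα h (by omega)

end pos

/-- Lengths can be made large. -/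
lemma grow1 (hα : Irrational α) (b : Bool) (n : ℕ) : ∀ L : Level A v x α D,
    L.δ (!b) ≤ n * L.δ b → ∃ L' : Level A v x α D, L.l b + 1 ≤ L'.l b ∧ L.l (!b) ≤ L'.l (!b) := by
  induction n with
  | zero => intro L h; have := L.δpos (!b); simp at h; linarith
  | succ n ih =>
    intro L h
    obtain ⟨i, hi⟩ := L.exists_iso hα
    rcases bool_cases b i with e | e
    · subst e
      refine ⟨L.step i hi, ?_, ?_⟩
      · rw [l_step, l'_i]; have := L.lpos (!i); omega
      · rw [l_step, l'_o]
    · obtain ⟨L', h1, h2⟩ := ih (L.step i hi) (by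
        change L.δ' i (!b) ≤ n * L.δ' i b
        rw [e]
        have e1 : L.δ' (!b) (!b) = L.δ (!b) - L.δ b := by simp [δ']
        have e2 : L.δ' (!b) b = L.δ b := by simp [δ']
        rw [e1, e2]
        push_cast at h
        linarith)
      have g1 := L.l'_ge i b
      have g2 := L.l'_ge i (!b)
      rw [l_step] at h1 h2
      exact ⟨L', by omega, by omega⟩

lemma grow (hα : Irrational α) (L : Level A v x α D) (n : ℕ) :
    ∃ L' : Level A v x α D, ∀ b, n ≤ L'.l b := by
  induction n with
  | zero => exact ⟨L, fun b => Nat.zero_le _⟩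
  | succ n ih =>
    obtain ⟨L1, h1⟩ := ih
    have key : ∀ (b : Bool) (L : Level A v x α D), ∃ L' : Level A v x α D,
      L.l b + 1 ≤ L'.l b ∧ L.l (!b) ≤ L'.l (!b) := by
      intro b L
      obtain ⟨m, hm⟩ := exists_nat_ge (L.δ (!b) / L.δ b)
      exact grow1 hα b m L (by rwa [div_le_iff₀ (L.δpos b)] at hm)
    obtain ⟨L2, a1, a2⟩ := key false L1
    obtain ⟨L3, b1, b2⟩ := key true L2
    simp only [Bool.not_false, Bool.not_true] at a2 b2
    have c1 := h1 false
    have c2 := h1 true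
    refine ⟨L3, fun b => ?_⟩
    cases b <;> omega

end Level

/-- The base level. -/
noncomputable def base (A : Bool → Mat2) (hA : ∀ b, (A b).det = 1) (v : ℤ → Bool) (α β D : ℝ)
    (hα : α ∈ Set.Ioo (0 : ℝ) 1)
    (hv : ∀ n : ℤ, (v n = true ↔ Int.fract ((n : ℝ) * α + β) ∈ Set.Ico (1 - α) 1))
    (hD : (A false).trace ^ 2 + (A true).trace ^ 2 + (A false * A true).trace ^ 2
    - (A false).trace * (A true).trace * (A false * A true).trace = D)
    (hne : ¬ ((A false).trace = 0 ∧ (A true).trace = 0 ∧ (A false * A true).trace = 0)) :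
    Level A v (fun n => Int.fract ((n : ℝ) * α + β) - (1 - α)) α D :=
  have hv' : ∀ n : ℤ, (v n = true ↔ 0 ≤ Int.fract ((n : ℝ) * α + β) - (1 - α)) := fun n => by
    rw [hv n]
    have := Int.fract_lt_one ((n : ℝ) * α + β)
    constructor
    · rintro ⟨h, -⟩; linarith
    · intro h; exact ⟨by linarith, this⟩
  have hF : ∀ n : ℤ, v n = false → Int.fract (((n + 1 : ℤ) : ℝ) * α + β) =
      Int.fract ((n : ℝ) * α + β) + α := fun n h => by
    have h1 := Int.fract_nonneg ((n : ℝ) * α + β)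
    have h0 := hα.1
    rw [← Bool.not_eq_true, hv' n] at h
    rw [Int.fract_eq_iff]
    refine ⟨by linarith, by linarith, ⌊(n : ℝ) * α + β⌋, ?_⟩
    have := Int.self_sub_floor ((n : ℝ) * α + β)
    push_cast; linarith
  have hT : ∀ n : ℤ, v n = true → Int.fract (((n + 1 : ℤ) : ℝ) * α + β) =
      Int.fract ((n : ℝ) * α + β) + α - 1 := fun n h => by
    have h1 := Int.fract_lt_one ((n : ℝ) * α + β)
    have h0 := hα.2
    rw [hv' n] at h
    rw [Int.fract_eq_iff]
    refine ⟨by linarith, by linarith, ⌊(n : ℝ) * α + β⌋ + 1, ?_⟩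
    have := Int.self_sub_floor ((n : ℝ) * α + β)
    push_cast; linarith
  { B := fun _ => True
    τ := v
    π := fun k => v (k - 1)
    l := fun _ => 1
    M := A
    δ := fun b => if b then 1 - α else α
    lpos := fun _ => le_rfl
    next := fun k _ => by simp
    prev := fun k _ => by simp
    same := fun k k' _ _ h i h0 h1 => by
      have : i = 0 := by push_cast at h1; omega
      subst this; simpa using h
    mat := fun k _ => T_one A v k
    cover := fun K => ⟨K, trivial, le_rfl, by simp⟩
    sa := fun k k' _ _ i h0 h1 => by push_cast at h1; omega
    det := hA
    hD := hD
    hne := hne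
    δpos := fun b => by cases b <;> simp [hα.1, hα.2]
    rng := fun k _ => by
      have h1 := Int.fract_lt_one ((k : ℝ) * α + β)
      have h2 := Int.fract_nonneg ((k : ℝ) * α + β)
      simp only [if_true, Bool.false_eq_true, if_false]
      constructor <;> linarith
    τx := fun k _ => hv' k
    πx := fun k _ => by
      have h1 := Int.fract_lt_one (((k - 1 : ℤ) : ℝ) * α + β)
      have h2 := Int.fract_nonneg (((k - 1 : ℤ) : ℝ) * α + β)
      simp only [if_true, Bool.false_eq_true, if_false]
      have e1 := hF (k - 1)
      have e2 := hT (k - 1)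
      have e3 := hv' (k - 1)
      rw [sub_add_cancel] at e1 e2
      cases hc : v (k - 1)
      · rw [e1 hc]
        rw [hc] at e3
        simp only [Bool.false_eq_true, false_iff] at e3 ⊢
        linarith
      · rw [e2 hc]
        simp only [true_iff]
        linarith
    stepF := fun k _ h => by
      simp only [Nat.cast_one, Bool.false_eq_true, if_false]
      rw [hF k h]; ring
    stepT := fun k _ h => by
      simp only [Nat.cast_one, if_true]
      rw [hT k h]; ring
    zF := ⟨0, by simp⟩
    zT := ⟨1, by simp; ring⟩ }

section main
variable {A : Bool → Mat2} {v ω : ℤ → Bool} {α β : ℝ}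

lemma exists_par (D : ℝ) : ∃ η, Level.Par D η := by
  by_cases h : 0 < D
  · have hm : 0 < min 1 D := lt_min one_pos h
    have h1 : min 1 D ≤ 1 := min_le_left _ _
    have h2 : min 1 D ≤ D := min_le_right _ _
    have e : 2 * (min 1 D / (8 * (D + 2))) * (D + 2) = min 1 D / 4 := by field_simp; norm_num
    have hpos : 0 < min 1 D / (8 * (D + 2)) := by positivity
    refine ⟨min 1 D / (8 * (D + 2)), hpos, fun _ => ?_, fun _ => ?_, ?_⟩
    · rw [e]; linarith
    · rw [e]; nlinarith
    · nlinarith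
  · exact ⟨1 / 2, by norm_num, fun h' => absurd h' h, fun h' => absurd h' h, by norm_num⟩

lemma no_decay (hA : ∀ b, (A b).det = 1)
    (hne : ¬ ((A false).trace = 0 ∧ (A true).trace = 0 ∧ (A false * A true).trace = 0))
    (hirr : Irrational α) (hα : α ∈ Set.Ioo (0 : ℝ) 1)
    (hv : ∀ n : ℤ, (v n = true ↔ Int.fract ((n : ℝ) * α + β) ∈ Set.Ico (1 - α) 1))
    (hω : ω ∈ Hull v) (X : ℤ → Fin 2 → ℝ) (hrec : ∀ n, X (n + 1) = A (ω n) *ᵥ X n)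
    (hX : ∀ n, X n ≠ 0) (hdec : Tendsto X cofinite (𝓝 0)) : False := by
  obtain ⟨η, q⟩ := exists_par ((A false).trace ^ 2 + (A true).trace ^ 2
    + (A false * A true).trace ^ 2
    - (A false).trace * (A true).trace * (A false * A true).trace)
  have hη := q.pos
  set ε := η * min ‖X 0‖ ‖X 1‖ with hε
  have hεpos : 0 < ε := mul_pos hη (lt_min (norm_pos_iff.2 (hX 0)) (norm_pos_iff.2 (hX 1)))
  have hev : ∀ᶠ j in cofinite, ‖X j‖ < ε := by
    have := (tendsto_zero_iff_norm_tendsto_zero.1 hdec).eventually (gt_mem_nhds hεpos)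
    exact this
  rw [Filter.eventually_cofinite] at hev
  obtain ⟨S, hS⟩ := (hev.image Int.natAbs).bddAbove
  have hdec' : ∀ j : ℤ, (S : ℤ) + 1 ≤ |j| → ‖X j‖ ≤ ε := by
    intro j hj
    by_contra hc
    have : j.natAbs ≤ S := hS ⟨j, by simp only [Set.mem_ofPred_eq]; linarith, rfl⟩
    rw [Int.abs_eq_natAbs] at hj
    omega
  obtain ⟨L, hL⟩ := (base A hA v α β _ hα hv rfl hne).grow hirr (S + 4)
  obtain ⟨n, -, hn⟩ := hω
  set R : ℤ := 32 * ((L.l false : ℤ) + L.l true) with hR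
  have hall : ∀ᶠ i in atTop, ∀ m ∈ Finset.Icc (-(R + 2)) (R + 2), v (m + (n i : ℤ)) = ω m :=
    (Finset.eventually_all _).2 fun m _ => hn m
  obtain ⟨i, hi⟩ := hall.exists
  set s : ℤ := (n i : ℤ) with hs
  have key : ∀ (M k : ℤ), (M = 0 ∨ M = 1) → L.B k → k + 2 ≤ s + M → s + M ≤ k + L.l (L.τ k) →
      False := by
    intro M k hM hB h1 h2
    have hl0 := hL false
    have hl1 := hL true
    have p : L.At (s + M) R ((S : ℤ) + 2) k :=
      ⟨hB, h1, h2, by omega, fun b => by have := hL b; omega⟩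
    have c : Ctx A v (fun k => X (k - s)) (s + M) R ((S : ℤ) + 2) η := by
      refine ⟨?_, ?_, ?_, hη, by omega⟩
      · intro j h3 h4
        have e := hi (j - s) (by rw [Finset.mem_Icc]; omega)
        rw [sub_add_cancel] at e
        have := hrec (j - s)
        rw [← e] at this
        rw [← this]
        congr 1; ring
      · intro j h3 _
        have : ‖X (j - s)‖ ≤ ε := hdec' _ (by
          rcases abs_cases (j - (s + M)) with ⟨a, b⟩ | ⟨a, b⟩ <;>
          rcases abs_cases (j - s) with ⟨a', b'⟩ | ⟨a', b'⟩ <;> omega)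
        refine this.trans ?_
        simp only [add_sub_cancel_left]
        rw [hε]
        refine mul_le_mul_of_nonneg_left ?_ hη.le
        rcases hM with rfl | rfl
        · exact min_le_left _ _
        · exact min_le_right _ _
      · exact hX _
    exact p.contra hA c q hirr (by omega)
  obtain ⟨k, hB, h1, h2⟩ := L.cover (s - 1)
  have := hL (L.τ k)
  by_cases h : k + 2 ≤ s
  · exact key 0 k (Or.inl rfl) hB (by omega) (by omega)
  · exact key 1 k (Or.inr rfl) hB (by omega) (by omega)

lemma no_real {𝔭 𝔮 E : ℝ} (h𝔭 : 𝔭 ≠ 0)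
    (hirr : Irrational α) (hα : α ∈ Set.Ioo (0 : ℝ) 1)
    (hv : ∀ n : ℤ, (v n = true ↔ Int.fract ((n : ℝ) * α + β) ∈ Set.Ico (1 - α) 1))
    (hω : ω ∈ Hull v) (u : ℤ → ℝ) (hu : Tendsto u cofinite (𝓝 0))
    (h : ∀ n, pCoef 𝔭 (ω (n + 1)) * u (n + 1) + pCoef 𝔭 (ω n) * u (n - 1)
      + qCoef 𝔮 (ω n) * u n = E * u n) (m : ℤ) : u m = 0 := by
  have hp : ∀ b, pCoef 𝔭 b ≠ 0 := fun b => by cases b <;> simp [pCoef, h𝔭]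
  set A : Bool → Mat2 := fun b =>
    !![(E - qCoef 𝔮 b) / pCoef 𝔭 b, -pCoef 𝔭 b; 1 / pCoef 𝔭 b, 0] with hAdef
  have hA : ∀ b, (A b).det = 1 := fun b => by
    rw [hAdef, Matrix.det_fin_two]; simp [hp b]
  have hne : ¬ ((A false).trace = 0 ∧ (A true).trace = 0 ∧ (A false * A true).trace = 0) := by
    rintro ⟨h1, h2, h3⟩
    simp [hAdef, Matrix.trace_fin_two, pCoef, qCoef] at h1 h2 h3
    rw [h1] at h3
    have : 𝔭 * 𝔭 + 1 = 0 := by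
      field_simp at h3
      linarith
    nlinarith [mul_self_nonneg 𝔭]
  set X : ℤ → Fin 2 → ℝ := fun n => ![pCoef 𝔭 (ω n) * u n, u (n - 1)] with hXdef
  have hrec : ∀ n, X (n + 1) = A (ω n) *ᵥ X n := by
    intro n
    have h1 := h n
    have h2 := hp (ω n)
    ext a
    fin_cases a
    · simp [hXdef, hAdef, Matrix.mulVec, dotProduct, Fin.sum_univ_two]
      field_simp
      linarith
    · simp [hXdef, hAdef, Matrix.mulVec, dotProduct, Fin.sum_univ_two]
      field_simp
  have hdec : Tendsto X cofinite (𝓝 0) := by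
    rw [tendsto_pi_nhds]
    intro a
    fin_cases a
    · have hb : ∀ n, |pCoef 𝔭 (ω n) * u n| ≤ (1 + |𝔭|) * |u n| := fun n => by
        rw [abs_mul]
        refine mul_le_mul_of_nonneg_right ?_ (abs_nonneg _)
        cases ω n <;> simp [pCoef]
      have : Tendsto (fun n => (1 + |𝔭|) * |u n|) cofinite (𝓝 0) := by
        have := (hu.abs).const_mul (1 + |𝔭|)
        simpa using this
      exact squeeze_zero_norm hb this
    · exact hu.comp ((sub_left_injective (b := (1 : ℤ))).tendsto_cofinite)
  by_contra hm
  refine no_decay hA hne hirr hα hv hω X hrec ?_ hdec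
  intro n hn
  have hall : ∀ j, X j = 0 := by
    intro j
    induction j using Int.inductionOn' (b := n) with
    | zero => exact hn
    | succ k _ ih => rw [hrec, ih, Matrix.mulVec_zero]
    | pred k _ ih =>
      have := hrec (k - 1)
      rw [sub_add_cancel, ih] at this
      by_contra hc
      have hd := (Matrix.exists_mulVec_eq_zero_iff (M := A (ω (k - 1)))).1 ⟨_, hc, this.symm⟩
      rw [hA] at hd
      exact one_ne_zero hd
  have := congrFun (hall (m + 1)) 1
  simp [hXdef] at this
  exact hm this

lemma energy_real {p : ℤ → ℝ} {q : ℤ → ℝ} {C : ℝ} (hp : ∀ n, |p n| ≤ C) (E : ℂ) (φ : ℤ → ℂ)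
    (hφ : Tendsto φ cofinite (𝓝 0))
    (h : ∀ n, (p (n + 1) : ℂ) * φ (n + 1) + (p n : ℂ) * φ (n - 1) + (q n : ℂ) * φ n = E * φ n)
    (m : ℤ) (hm : φ m ≠ 0) : E.im = 0 := by
  set c : ℤ → ℝ := fun n => p n * ((φ n).im * (φ (n - 1)).re - (φ n).re * (φ (n - 1)).im) with hc
  have hstep : ∀ n, c (n + 1) = c n + E.im * ((φ n).re ^ 2 + (φ n).im ^ 2) := by
    intro n
    have h1 := congrArg Complex.re (h n)
    have h2 := congrArg Complex.im (h n)
    simp at h1 h2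
    simp only [hc, add_sub_cancel_right]
    linear_combination (φ n).re * h2 - (φ n).im * h1
  have hre : Tendsto (fun n => (φ n).re) cofinite (𝓝 0) := by
    exact (Complex.continuous_re.tendsto' 0 0 rfl).comp hφ
  have him : Tendsto (fun n => (φ n).im) cofinite (𝓝 0) := by
    exact (Complex.continuous_im.tendsto' 0 0 rfl).comp hφ
  have hsh : Tendsto (fun n : ℤ => n - 1) cofinite cofinite :=
    (sub_left_injective (b := (1 : ℤ))).tendsto_cofinite
  have hc0 : Tendsto c cofinite (𝓝 0) := by
    have h3 : Tendsto (fun n => C * |(φ n).im * (φ (n - 1)).re - (φ n).re * (φ (n - 1)).im|)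
        cofinite (𝓝 0) := by
      have := (((him.mul (hre.comp hsh)).sub (hre.mul (him.comp hsh))).abs).const_mul C
      simpa using this
    refine squeeze_zero_norm (fun n => ?_) h3
    rw [hc, Real.norm_eq_abs, abs_mul]
    exact mul_le_mul_of_nonneg_right (hp n) (abs_nonneg _)
  have hd0 : Tendsto (fun n => E.im * c n) cofinite (𝓝 0) := by
    simpa using hc0.const_mul E.im
  have hmono : Monotone (fun n => E.im * c n) := by
    refine monotone_int_of_le_succ fun n => ?_
    rw [hstep]
    nlinarith [mul_nonneg (sq_nonneg E.im) (add_nonneg (sq_nonneg (φ n).re) (sq_nonneg (φ n).im))]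
  rw [Int.cofinite_eq] at hd0
  have ht := hd0.mono_left le_sup_right
  have hb := hd0.mono_left le_sup_left
  have hz : ∀ n, E.im * c n = 0 := fun n =>
    le_antisymm (hmono.ge_of_tendsto ht n) (hmono.le_of_tendsto hb n)
  have e1 := hz (m + 1)
  have e0 := hz m
  rw [hstep, mul_add, e0] at e1
  have hpos : 0 < (φ m).re ^ 2 + (φ m).im ^ 2 := by
    have := Complex.normSq_pos.2 hm
    rw [Complex.normSq_apply] at this
    nlinarith
  by_contra hE
  have : 0 < E.im ^ 2 := by positivity
  nlinarith [mul_pos this hpos]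

end main

end SturmJacobi

/-- For a primitive invertible two-letter substitution sequence `v`,
`(𝔭,𝔮) ≠ (1,0)`, `𝔭 ≠ 0`, and every `ω` in the hull of `v`, the Jacobi operator
`H_{ω,(𝔭,𝔮)}` has empty point spectrum. -/
theorem empty_point_spectrum (v : ℤ → Bool) (hv : IsSubstSeq v)
    (𝔭 𝔮 : ℝ) (h𝔭 : 𝔭 ≠ 0) (hpq : (𝔭, 𝔮) ≠ (1, 0))
    (ω : ℤ → Bool) (hω : ω ∈ Hull v)
    (H : JacobiSpace →L[ℂ] JacobiSpace) (hH : IsJacobi 𝔭 𝔮 ω H) :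
    ¬ ∃ (E : ℂ) (φ : JacobiSpace), φ ≠ 0 ∧ H φ = E • φ := by
  rintro ⟨E, φ, hφ, hE⟩
  obtain ⟨s, -, -, -, α, β, hirr, hα, hv⟩ := hv
  have h : ∀ n, (pCoef 𝔭 (ω (n + 1)) : ℂ) * (φ : ∀ _ : ℤ, ℂ) (n + 1) +
      (pCoef 𝔭 (ω n) : ℂ) * (φ : ∀ _ : ℤ, ℂ) (n - 1) +
      (qCoef 𝔮 (ω n) : ℂ) * (φ : ∀ _ : ℤ, ℂ) n = E * (φ : ∀ _ : ℤ, ℂ) n := by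
    intro n
    rw [← hH φ n, hE]
    simp
  have ht : Tendsto (fun n => (φ : ∀ _ : ℤ, ℂ) n) cofinite (𝓝 0) := by
    have h1 := (lp.memℓp φ).summable (by norm_num)
    have h2 := h1.tendsto_cofinite_zero
    rw [tendsto_zero_iff_norm_tendsto_zero]
    have h3 := h2.sqrt
    simpa [Real.sqrt_sq] using h3
  have hreE : E.im = 0 := by
    obtain ⟨m, hm⟩ : ∃ m, (φ : ∀ _ : ℤ, ℂ) m ≠ 0 := by
      by_contra hc
      push Not at hc
      exact hφ (lp.ext (funext hc))
    exact SturmJacobi.energy_real (p := fun n => pCoef 𝔭 (ω n)) (q := fun n => qCoef 𝔮 (ω n))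
      (C := 1 + |𝔭|) (fun n => by cases hb : ω n <;> simp [pCoef]) E _ ht h m hm
  have hre : Tendsto (fun n => ((φ : ∀ _ : ℤ, ℂ) n).re) cofinite (𝓝 0) := by
    exact (Complex.continuous_re.tendsto' 0 0 rfl).comp ht
  have him : Tendsto (fun n => ((φ : ∀ _ : ℤ, ℂ) n).im) cofinite (𝓝 0) := by
    exact (Complex.continuous_im.tendsto' 0 0 rfl).comp ht
  have z1 := SturmJacobi.no_real (𝔮 := 𝔮) (E := E.re) h𝔭 hirr hα hv hω _ hre (fun n => by
    have := congrArg Complex.re (h n)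
    simpa [hreE] using this)
  have z2 := SturmJacobi.no_real (𝔮 := 𝔮) (E := E.re) h𝔭 hirr hα hv hω _ him (fun n => by
    have := congrArg Complex.im (h n)
    simpa [hreE] using this)
  exact hφ (lp.ext (funext fun n => Complex.ext (z1 n) (z2 n)))
end

section
/- Let v be a primitive invertible two-letter substitution sequence generated by the substitution s (with s(0) beginning in 0), let 𝔭 ∈ ℝ∖{0} and 𝔮 ∈ ℝ with (𝔭,𝔮) ≠ (1,0). For each k, let v^{(k)} ∈ {0,1}^ℤ be the two-sided periodic sequence of period |s^k(0)| obtained by repeating the word s^k(0), let H^{(k)}_{v,(𝔭,𝔮)} be the associated Jacobi operator and σ_k its spectrum. Then σ_k converges to Σ_{v,(𝔭,𝔮)} in the Hausdorff metric as k → ∞. -/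
open Filter Topology

/-- The two-sided periodic sequence obtained by repeating the finite word `w`. -/
def periodicSeq (w : List Bool) : ℤ → Bool :=
  fun n => w.getD (n % (w.length : ℤ)).toNat false

section AbstractOperator

variable {F : Type*} [NormedAddCommGroup F] [InnerProductSpace ℂ F] [CompleteSpace F]

/-- A point of the spectrum of a self-adjoint operator is an approximate eigenvalue. -/
theorem exists_approx_eigenvector (A : F →L[ℂ] F) (hA : IsSelfAdjoint A) (E : ℝ)
    (hE : (E : ℂ) ∈ spectrum ℂ A) (δ : ℝ) (hδ : 0 < δ) :
    ∃ x : F, x ≠ 0 ∧ ‖A x - (E : ℂ) • x‖ ≤ δ * ‖x‖ := by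
  by_contra hcon
  push Not at hcon
  rw [spectrum.mem_iff] at hE
  apply hE
  set T : F →L[ℂ] F := algebraMap ℂ (F →L[ℂ] F) (E : ℂ) - A with hT
  have hTx : ∀ x, T x = (E : ℂ) • x - A x := by
    intro x
    simp [hT, Algebra.algebraMap_eq_smul_one]
  have hTsa : IsSelfAdjoint T := by
    refine IsSelfAdjoint.sub ?_ hA
    rw [isSelfAdjoint_iff, ← algebraMap_star_comm]
    simp
  have hlow : ∀ x, δ * ‖x‖ ≤ ‖T x‖ := by
    intro x
    by_cases hx : x = 0
    · simp [hx]
    · have := hcon x hx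
      rw [hTx, norm_sub_rev]
      exact this.le
  rw [ContinuousLinearMap.isUnit_iff_bijective,
    ContinuousLinearMap.bijective_iff_dense_range_and_antilipschitz]
  constructor
  · rw [Submodule.topologicalClosure_eq_top_iff, ContinuousLinearMap.orthogonal_range]
    have : ContinuousLinearMap.adjoint T = T := by
      rw [← ContinuousLinearMap.star_eq_adjoint]; exact hTsa
    rw [this, Submodule.eq_bot_iff]
    intro x hx
    have hx0 : T x = 0 := by simpa using hx
    have := hlow x
    rw [hx0, norm_zero] at this
    have h2 : ‖x‖ ≤ 0 := by nlinarith [norm_nonneg x]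
    simpa using h2
  · refine ⟨⟨δ⁻¹, by positivity⟩, ContinuousLinearMap.antilipschitz_of_bound _ ?_⟩
    intro x
    have := hlow x
    change ‖x‖ ≤ δ⁻¹ * ‖T x‖
    rw [inv_mul_eq_div, le_div_iff₀ hδ]
    linarith

/-- An approximate eigenvalue of a self-adjoint operator is close to its spectrum. -/
theorem exists_spectrum_near (A : F →L[ℂ] F) (hA : IsSelfAdjoint A) (E : ℝ) (ε : ℝ)
    (hε : 0 < ε) (x : F) (hx : x ≠ 0) (hxE : ‖A x - (E : ℂ) • x‖ ≤ ε * ‖x‖) :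
    ∃ E' : ℝ, (E' : ℂ) ∈ spectrum ℂ A ∧ |E - E'| ≤ ε := by
  by_cases hE : (E : ℂ) ∈ spectrum ℂ A
  · exact ⟨E, hE, by simpa using hε.le⟩
  rw [spectrum.notMem_iff] at hE
  obtain ⟨U, hU⟩ := hE
  have hTx : ∀ y, (U : F →L[ℂ] F) y = (E : ℂ) • y - A y := by
    intro y
    simp [hU, Algebra.algebraMap_eq_smul_one]
  have hTsa : IsSelfAdjoint (U : F →L[ℂ] F) := by
    rw [hU]
    refine IsSelfAdjoint.sub ?_ hA
    rw [isSelfAdjoint_iff, ← algebraMap_star_comm]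
    simp
  have hUsa : star U = U := Units.ext hTsa
  have hRsa : IsSelfAdjoint ((U⁻¹ : (F →L[ℂ] F)ˣ) : F →L[ℂ] F) := by
    rw [isSelfAdjoint_iff, ← Units.coe_star, star_inv, hUsa]
  have : Nontrivial F := ⟨⟨x, 0, hx⟩⟩
  obtain ⟨z, hz, hzr⟩ := spectrum.exists_nnnorm_eq_spectralRadius
    ((U⁻¹ : (F →L[ℂ] F)ˣ) : F →L[ℂ] F)
  rw [hRsa.spectralRadius_eq_nnnorm] at hzr
  have hzn : ‖z‖ = ‖((U⁻¹ : (F →L[ℂ] F)ˣ) : F →L[ℂ] F)‖ := by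
    have : ‖z‖₊ = ‖((U⁻¹ : (F →L[ℂ] F)ˣ) : F →L[ℂ] F)‖₊ := by exact_mod_cast hzr
    exact congrArg NNReal.toReal this
  have hxpos : 0 < ‖x‖ := norm_pos_iff.mpr hx
  have hb : ‖x‖ ≤ ‖z‖ * (ε * ‖x‖) := by
    have h1 : ((U⁻¹ : (F →L[ℂ] F)ˣ) : F →L[ℂ] F) ((U : F →L[ℂ] F) x) = x := by
      have : (((U⁻¹ : (F →L[ℂ] F)ˣ) : F →L[ℂ] F) * (U : F →L[ℂ] F)) x = x := by
        rw [Units.inv_mul]; rfl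
      exact this
    calc ‖x‖ = ‖((U⁻¹ : (F →L[ℂ] F)ˣ) : F →L[ℂ] F) ((U : F →L[ℂ] F) x)‖ := by rw [h1]
      _ ≤ ‖z‖ * ‖(U : F →L[ℂ] F) x‖ := by rw [hzn]; exact ContinuousLinearMap.le_opNorm _ _
      _ ≤ ‖z‖ * (ε * ‖x‖) := by
        gcongr
        rw [hTx, norm_sub_rev]
        exact hxE
  have hzε : 1 ≤ ‖z‖ * ε := by
    have : 1 * ‖x‖ ≤ (‖z‖ * ε) * ‖x‖ := by linarith
    exact le_of_mul_le_mul_right this hxpos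
  have hz0 : z ≠ 0 := by
    rintro rfl
    simp at hzε
    linarith
  have hmem : z⁻¹ ∈ spectrum ℂ (U : F →L[ℂ] F) := by
    have := (spectrum.inv_mem_iff (R := ℂ) (r := Units.mk0 z⁻¹ (inv_ne_zero hz0)) (a := U)).mpr
    simp only [Units.val_mk0, Units.val_inv_eq_inv_val, inv_inv] at this
    exact this hz
  have hmem2 : (E : ℂ) - z⁻¹ ∈ spectrum ℂ A := by
    rw [spectrum.mem_iff] at hmem ⊢
    intro h
    apply hmem
    have : algebraMap ℂ (F →L[ℂ] F) z⁻¹ - (U : F →L[ℂ] F)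
        = -(algebraMap ℂ (F →L[ℂ] F) ((E : ℂ) - z⁻¹) - A) := by
      rw [hU, map_sub]; abel
    rw [this]
    exact h.neg
  have hre := hA.mem_spectrum_eq_re hmem2
  refine ⟨((E : ℂ) - z⁻¹).re, by rw [← hre]; exact hmem2, ?_⟩
  have h3 : ((E - ((E : ℂ) - z⁻¹).re : ℝ) : ℂ) = z⁻¹ := by
    rw [Complex.ofReal_sub, ← hre]; ring
  have h4 : |E - ((E : ℂ) - z⁻¹).re| = ‖z‖⁻¹ := by
    rw [← Real.norm_eq_abs, ← Complex.norm_real, h3, norm_inv]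
  rw [h4]
  have hzp : 0 < ‖z‖ := norm_pos_iff.mpr hz0
  rw [inv_le_iff_one_le_mul₀ hzp]
  linarith

end AbstractOperator

section JacobiOperators

theorem pCoef_abs_le (𝔭 : ℝ) (b : Bool) : |pCoef 𝔭 b| ≤ 1 + |𝔭| := by
  cases b
  · simp [pCoef]
  · simp [pCoef]

theorem qCoef_abs_le (𝔮 : ℝ) (b : Bool) : |qCoef 𝔮 b| ≤ |𝔮| := by
  cases b
  · simp [qCoef]
  · simp [qCoef]

theorem jacobiSpace_summable_sq (x : JacobiSpace) :
    Summable (fun n : ℤ => ‖(x : ∀ _ : ℤ, ℂ) n‖ ^ 2) := by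
  have h := (memℓp_gen_iff (E := fun _ : ℤ => ℂ) (p := 2) (by simp)).mp (lp.memℓp x)
  simpa using h

theorem jacobiSpace_mem (f : ℤ → ℂ) (hf : Summable (fun n : ℤ => ‖f n‖ ^ 2)) :
    Memℓp (E := fun _ : ℤ => ℂ) f 2 := by
  rw [memℓp_gen_iff (by simp)]
  simpa using hf

theorem jacobiSpace_norm_sq (x : JacobiSpace) :
    ‖x‖ ^ 2 = ∑' n : ℤ, ‖(x : ∀ _ : ℤ, ℂ) n‖ ^ 2 := by
  have h := lp.norm_rpow_eq_tsum (E := fun _ : ℤ => ℂ) (p := 2) (by simp) x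
  simpa using h

theorem jacobiSpace_ofReal_norm_sq (x : JacobiSpace) :
    ENNReal.ofReal (‖x‖ ^ 2) = ∑' n : ℤ, ENNReal.ofReal (‖(x : ∀ _ : ℤ, ℂ) n‖ ^ 2) := by
  rw [jacobiSpace_norm_sq, ENNReal.ofReal_tsum_of_nonneg (fun n => by positivity)
    (jacobiSpace_summable_sq x)]

theorem summable_shifted_product (c : ℤ → ℝ) (C : ℝ) (hc : ∀ n, |c n| ≤ C)
    (x y : JacobiSpace) (i j : ℤ) :
    Summable (fun n : ℤ => (c n : ℂ) * starRingEnd ℂ ((x : ∀ _ : ℤ, ℂ) (n + i))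
      * (y : ∀ _ : ℤ, ℂ) (n + j)) := by
  have hC : 0 ≤ C := (abs_nonneg _).trans (hc 0)
  have hx := ((Equiv.addRight i).summable_iff).mpr (jacobiSpace_summable_sq x)
  have hy := ((Equiv.addRight j).summable_iff).mpr (jacobiSpace_summable_sq y)
  refine Summable.of_norm_bounded ((hx.add hy).mul_left C) ?_
  intro n
  simp only [norm_mul, Complex.norm_real, Real.norm_eq_abs, RCLike.norm_conj, Function.comp,
    Equiv.coe_addRight]
  set u := ‖(x : ∀ _ : ℤ, ℂ) (n + i)‖ with hu
  set w := ‖(y : ∀ _ : ℤ, ℂ) (n + j)‖ with hw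
  have hu0 : 0 ≤ u := norm_nonneg _
  have hw0 : 0 ≤ w := norm_nonneg _
  calc |c n| * u * w = |c n| * (u * w) := by ring
    _ ≤ C * (u * w) := by gcongr; exact hc n
    _ ≤ C * (u ^ 2 + w ^ 2) := by
      gcongr
      nlinarith [sq_nonneg (u - w), mul_nonneg hu0 hw0]

theorem tsum_shift_swap (A B Q : ℤ → ℂ) (sA : Summable A) (sB : Summable B) (sQ : Summable Q) :
    ∑' n, (A (n + 1) + B n + Q n) = ∑' n, (B (n + 1) + A n + Q n) := by
  have sA' : Summable (fun n => A (n + 1)) := ((Equiv.addRight (1 : ℤ)).summable_iff).mpr sA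
  have sB' : Summable (fun n => B (n + 1)) := ((Equiv.addRight (1 : ℤ)).summable_iff).mpr sB
  have eA : ∑' n, A (n + 1) = ∑' n, A n := (Equiv.addRight (1 : ℤ)).tsum_eq A
  have eB : ∑' n, B (n + 1) = ∑' n, B n := (Equiv.addRight (1 : ℤ)).tsum_eq B
  rw [(sA'.add sB).tsum_add sQ, sA'.tsum_add sB,
    (sB'.add sA).tsum_add sQ, sB'.tsum_add sA, eA, eB, add_comm (∑' n, A n)]

theorem isJacobi_inner (𝔭 𝔮 : ℝ) (ω : ℤ → Bool) (H : JacobiSpace →L[ℂ] JacobiSpace)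
    (hH : IsJacobi 𝔭 𝔮 ω H) (x y : JacobiSpace) : inner ℂ (H x) y = inner ℂ x (H y) := by
  have sA := summable_shifted_product _ _ (fun n => pCoef_abs_le 𝔭 (ω n)) x y 0 (-1)
  have sB := summable_shifted_product _ _ (fun n => pCoef_abs_le 𝔭 (ω n)) x y (-1) 0
  have sQ := summable_shifted_product _ _ (fun n => qCoef_abs_le 𝔮 (ω n)) x y 0 0
  have key := tsum_shift_swap _ _ _ sA sB sQ
  rw [lp.inner_eq_tsum, lp.inner_eq_tsum]
  refine Eq.trans (tsum_congr fun n => ?_) (key.trans (tsum_congr fun n => ?_))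
  · rw [hH x n]
    simp only [RCLike.inner_apply, map_add, map_mul, Complex.conj_ofReal, add_zero,
      ← sub_eq_add_neg, add_sub_cancel_right]
    ring
  · rw [hH y n]
    simp only [RCLike.inner_apply, add_zero,
      ← sub_eq_add_neg, add_sub_cancel_right]
    ring

theorem isJacobi_isSelfAdjoint (𝔭 𝔮 : ℝ) (ω : ℤ → Bool) (H : JacobiSpace →L[ℂ] JacobiSpace)
    (hH : IsJacobi 𝔭 𝔮 ω H) : IsSelfAdjoint H := by
  rw [ContinuousLinearMap.isSelfAdjoint_iff_isSymmetric]
  intro x y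
  exact isJacobi_inner 𝔭 𝔮 ω H hH x y

/-- Restriction of `φ` to the window `[a, a + M)`. -/
noncomputable def truncate (φ : JacobiSpace) (M : ℕ) (a : ℤ) : JacobiSpace :=
  ⟨fun n => if a ≤ n ∧ n < a + M then (φ : ∀ _ : ℤ, ℂ) n else 0, by
    refine jacobiSpace_mem _ (Summable.of_nonneg_of_le (fun n => by positivity) (fun n => ?_)
      (jacobiSpace_summable_sq φ))
    split_ifs
    · exact le_rfl
    · simp⟩

theorem truncate_apply (φ : JacobiSpace) (M : ℕ) (a n : ℤ) :
    (truncate φ M a : ∀ _ : ℤ, ℂ) n =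
      if a ≤ n ∧ n < a + M then (φ : ∀ _ : ℤ, ℂ) n else 0 := rfl

theorem tsum_window_const (M : ℕ) (n : ℤ) (t : ENNReal) :
    ∑' a : ℤ, (if a ≤ n ∧ n < a + M then t else 0) = M * t := by
  rw [tsum_eq_sum (s := Finset.Ioc (n - M) n)]
  · rw [Finset.sum_congr rfl (g := fun _ => t)]
    · simp
    · intro a ha
      rw [Finset.mem_Ioc] at ha
      rw [if_pos ⟨ha.2, by linarith⟩]
  · intro a ha
    rw [Finset.mem_Ioc] at ha
    rw [if_neg]
    rintro ⟨h1, h2⟩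
    exact ha ⟨by linarith, h1⟩

theorem sum_truncate (φ : JacobiSpace) (M : ℕ) :
    ∑' a : ℤ, ENNReal.ofReal (‖truncate φ M a‖ ^ 2) = M * ENNReal.ofReal (‖φ‖ ^ 2) := by
  simp_rw [jacobiSpace_ofReal_norm_sq]
  rw [ENNReal.tsum_comm, ← ENNReal.tsum_mul_left]
  refine tsum_congr fun n => ?_
  rw [← tsum_window_const M n]
  refine tsum_congr fun a => ?_
  rw [truncate_apply]
  split_ifs <;> simp

theorem sq_sum_five_le (C : ℝ) (u v w e f : ℝ)
    (x : ℝ) (hx0 : 0 ≤ x) (hx : x ≤ u + C * v + C * w + C * e + C * f) :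
    x ^ 2 ≤ 5 * (u ^ 2 + C ^ 2 * v ^ 2 + C ^ 2 * w ^ 2 + C ^ 2 * e ^ 2 + C ^ 2 * f ^ 2) := by
  have : x ^ 2 ≤ (u + C * v + C * w + C * e + C * f) ^ 2 := pow_le_pow_left₀ hx0 hx 2
  nlinarith [sq_nonneg (u - C * v), sq_nonneg (u - C * w), sq_nonneg (u - C * e),
    sq_nonneg (u - C * f), sq_nonneg (C * v - C * w), sq_nonneg (C * v - C * e),
    sq_nonneg (C * v - C * f), sq_nonneg (C * w - C * e), sq_nonneg (C * w - C * f),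
    sq_nonneg (C * e - C * f)]

theorem truncate_pointwise (𝔭 𝔮 : ℝ) (ω : ℤ → Bool) (H : JacobiSpace →L[ℂ] JacobiSpace)
    (hH : IsJacobi 𝔭 𝔮 ω H) (E : ℝ) (φ : JacobiSpace) (M : ℕ) (a n : ℤ) :
    ENNReal.ofReal (‖(H (truncate φ M a) - (E : ℂ) • truncate φ M a : JacobiSpace) n‖ ^ 2) ≤
      5 * ((if a ≤ n ∧ n < a + M then
          ENNReal.ofReal (‖(H φ - (E : ℂ) • φ : JacobiSpace) n‖ ^ 2) else 0)
        + ENNReal.ofReal ((1 + |𝔭|) ^ 2) *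
            (if a = n + 1 then ENNReal.ofReal (‖(φ : ∀ _ : ℤ, ℂ) (n + 1)‖ ^ 2) else 0)
        + ENNReal.ofReal ((1 + |𝔭|) ^ 2) *
            (if a = n + 1 - M then ENNReal.ofReal (‖(φ : ∀ _ : ℤ, ℂ) (n + 1)‖ ^ 2) else 0)
        + ENNReal.ofReal ((1 + |𝔭|) ^ 2) *
            (if a = n then ENNReal.ofReal (‖(φ : ∀ _ : ℤ, ℂ) (n - 1)‖ ^ 2) else 0)
        + ENNReal.ofReal ((1 + |𝔭|) ^ 2) *
            (if a = n - M then ENNReal.ofReal (‖(φ : ∀ _ : ℤ, ℂ) (n - 1)‖ ^ 2) else 0)) := by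
  set C := 1 + |𝔭| with hC
  set X := ‖(H φ - (E : ℂ) • φ : JacobiSpace) n‖ with hX
  set P := ‖(φ : ∀ _ : ℤ, ℂ) (n + 1)‖ with hP
  set R := ‖(φ : ∀ _ : ℤ, ℂ) (n - 1)‖ with hR
  have key : ‖(H (truncate φ M a) - (E : ℂ) • truncate φ M a : JacobiSpace) n‖ ^ 2 ≤
      5 * ((if a ≤ n ∧ n < a + M then X else 0) ^ 2
        + C ^ 2 * (if a = n + 1 then P else 0) ^ 2
        + C ^ 2 * (if a = n + 1 - M then P else 0) ^ 2
        + C ^ 2 * (if a = n then R else 0) ^ 2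
        + C ^ 2 * (if a = n - M then R else 0) ^ 2) := by
    apply sq_sum_five_le
    · positivity
    have hC0 : 0 ≤ C := by positivity
    have e1 : (H (truncate φ M a) - (E : ℂ) • truncate φ M a : JacobiSpace) n =
        (if a ≤ n ∧ n < a + M then (H φ - (E : ℂ) • φ : JacobiSpace) n else 0)
        + (pCoef 𝔭 (ω (n + 1)) : ℂ) * ((truncate φ M a : ∀ _ : ℤ, ℂ) (n + 1) -
            (if a ≤ n ∧ n < a + M then (φ : ∀ _ : ℤ, ℂ) (n + 1) else 0))
        + (pCoef 𝔭 (ω n) : ℂ) * ((truncate φ M a : ∀ _ : ℤ, ℂ) (n - 1) -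
            (if a ≤ n ∧ n < a + M then (φ : ∀ _ : ℤ, ℂ) (n - 1) else 0)) := by
      simp only [lp.coeFn_sub, lp.coeFn_smul, Pi.sub_apply, Pi.smul_apply, smul_eq_mul, hH _ n,
        truncate_apply φ M a n]
      split_ifs
      · ring
      · ring
    have e2 : ‖(truncate φ M a : ∀ _ : ℤ, ℂ) (n + 1) -
            (if a ≤ n ∧ n < a + M then (φ : ∀ _ : ℤ, ℂ) (n + 1) else 0)‖ ≤
        (if a = n + 1 then P else 0) + (if a = n + 1 - M then P else 0) := by
      have hP0 : 0 ≤ P := norm_nonneg _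
      rw [truncate_apply]
      split_ifs <;> first
        | (exfalso; omega)
        | (simp only [sub_self, sub_zero, zero_sub, norm_zero, norm_neg]; linarith)
    have e3 : ‖(truncate φ M a : ∀ _ : ℤ, ℂ) (n - 1) -
            (if a ≤ n ∧ n < a + M then (φ : ∀ _ : ℤ, ℂ) (n - 1) else 0)‖ ≤
        (if a = n then R else 0) + (if a = n - M then R else 0) := by
      have hR0 : 0 ≤ R := norm_nonneg _
      rw [truncate_apply]
      split_ifs <;> first
        | (exfalso; omega)
        | (simp only [sub_self, sub_zero, zero_sub, norm_zero, norm_neg]; linarith)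
    have e4 : ‖(if a ≤ n ∧ n < a + M then (H φ - (E : ℂ) • φ : JacobiSpace) n else 0)‖
        = if a ≤ n ∧ n < a + M then X else 0 := by
      split_ifs
      · rfl
      · simp
    have e5 : ∀ b : Bool, ∀ z : ℂ, ∀ t : ℝ, ‖z‖ ≤ t → ‖(pCoef 𝔭 b : ℂ) * z‖ ≤ C * t := by
      intro b z t ht
      rw [norm_mul, Complex.norm_real, Real.norm_eq_abs]
      exact mul_le_mul (pCoef_abs_le 𝔭 b) ht (norm_nonneg _) hC0
    have e6 := e5 (ω (n + 1)) _ _ e2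
    have e7 := e5 (ω n) _ _ e3
    rw [e1]
    refine (norm_add₃_le).trans ?_
    rw [e4]
    linarith
  refine (ENNReal.ofReal_le_ofReal key).trans (le_of_eq ?_)
  have hite : ∀ (p : Prop) [Decidable p] (t : ℝ),
      ENNReal.ofReal ((if p then t else 0) ^ 2) = if p then ENNReal.ofReal (t ^ 2) else 0 := by
    intro p _ t
    split_ifs <;> simp
  rw [ENNReal.ofReal_mul (by norm_num), ENNReal.ofReal_add (by positivity) (by positivity),
    ENNReal.ofReal_add (by positivity) (by positivity),
    ENNReal.ofReal_add (by positivity) (by positivity),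
    ENNReal.ofReal_add (by positivity) (by positivity),
    ENNReal.ofReal_mul (by positivity), ENNReal.ofReal_mul (by positivity),
    ENNReal.ofReal_mul (by positivity), ENNReal.ofReal_mul (by positivity)]
  simp only [hite]
  simp

theorem sum_truncate_image_le (𝔭 𝔮 : ℝ) (ω : ℤ → Bool) (H : JacobiSpace →L[ℂ] JacobiSpace)
    (hH : IsJacobi 𝔭 𝔮 ω H) (E : ℝ) (φ : JacobiSpace) (M : ℕ) :
    ∑' a : ℤ, ENNReal.ofReal (‖H (truncate φ M a) - (E : ℂ) • truncate φ M a‖ ^ 2) ≤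
      ENNReal.ofReal (5 * (M * ‖H φ - (E : ℂ) • φ‖ ^ 2 + 4 * (1 + |𝔭|) ^ 2 * ‖φ‖ ^ 2)) := by
  set C2 := ENNReal.ofReal ((1 + |𝔭|) ^ 2) with hC2
  have hs1 : ∑' n : ℤ, ENNReal.ofReal (‖(φ : ∀ _ : ℤ, ℂ) (n + 1)‖ ^ 2)
      = ENNReal.ofReal (‖φ‖ ^ 2) := by
    rw [jacobiSpace_ofReal_norm_sq]
    exact (Equiv.addRight (1 : ℤ)).tsum_eq
      (fun n => ENNReal.ofReal (‖(φ : ∀ _ : ℤ, ℂ) n‖ ^ 2))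
  have hs2 : ∑' n : ℤ, ENNReal.ofReal (‖(φ : ∀ _ : ℤ, ℂ) (n - 1)‖ ^ 2)
      = ENNReal.ofReal (‖φ‖ ^ 2) := by
    rw [jacobiSpace_ofReal_norm_sq]
    exact (Equiv.subRight (1 : ℤ)).tsum_eq
      (fun n => ENNReal.ofReal (‖(φ : ∀ _ : ℤ, ℂ) n‖ ^ 2))
  calc ∑' a : ℤ, ENNReal.ofReal (‖H (truncate φ M a) - (E : ℂ) • truncate φ M a‖ ^ 2)
      = ∑' a : ℤ, ∑' n : ℤ, ENNReal.ofReal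
          (‖(H (truncate φ M a) - (E : ℂ) • truncate φ M a : JacobiSpace) n‖ ^ 2) := by
        simp_rw [jacobiSpace_ofReal_norm_sq]
    _ ≤ _ := ENNReal.tsum_le_tsum fun a => ENNReal.tsum_le_tsum fun n =>
        truncate_pointwise 𝔭 𝔮 ω H hH E φ M a n
    _ = 5 * (M * ENNReal.ofReal (‖H φ - (E : ℂ) • φ‖ ^ 2) + C2 * ENNReal.ofReal (‖φ‖ ^ 2)
          + C2 * ENNReal.ofReal (‖φ‖ ^ 2) + C2 * ENNReal.ofReal (‖φ‖ ^ 2)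
          + C2 * ENNReal.ofReal (‖φ‖ ^ 2)) := by
        rw [ENNReal.tsum_comm]
        simp only [ENNReal.tsum_mul_left, ENNReal.tsum_add, tsum_window_const, tsum_ite_eq,
          hs1, hs2, ← jacobiSpace_ofReal_norm_sq, hC2]
    _ = _ := by
        rw [ENNReal.ofReal_mul (by norm_num), ENNReal.ofReal_add (by positivity) (by positivity),
          ENNReal.ofReal_mul (by positivity), ENNReal.ofReal_mul (by positivity),
          ENNReal.ofReal_mul (by positivity)]
        simp only [ENNReal.ofReal_natCast, ENNReal.ofReal_ofNat]
        ring

theorem exists_localized (𝔭 𝔮 : ℝ) (ε : ℝ) (hε : 0 < ε) :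
    ∃ M : ℕ, ∀ (ω : ℤ → Bool) (H : JacobiSpace →L[ℂ] JacobiSpace), IsJacobi 𝔭 𝔮 ω H →
      ∀ E : ℝ, (E : ℂ) ∈ spectrum ℂ H → ∃ (a : ℤ) (ψ : JacobiSpace),
        (∀ n : ℤ, ¬ (a ≤ n ∧ n < a + M) → (ψ : ∀ _ : ℤ, ℂ) n = 0) ∧ ψ ≠ 0 ∧
        ‖H ψ - (E : ℂ) • ψ‖ ≤ ε * ‖ψ‖ := by
  obtain ⟨M, hM⟩ := exists_nat_gt (40 * (1 + |𝔭|) ^ 2 / ε ^ 2)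
  rw [div_lt_iff₀ (by positivity)] at hM
  refine ⟨M, fun ω H hH E hE => ?_⟩
  obtain ⟨φ, hφ0, hφ⟩ := exists_approx_eigenvector H (isJacobi_isSelfAdjoint 𝔭 𝔮 ω H hH) E hE
    (ε / 4) (by positivity)
  by_contra hcon
  push Not at hcon
  have hlow : ∀ a : ℤ, ENNReal.ofReal (ε ^ 2) * ENNReal.ofReal (‖truncate φ M a‖ ^ 2) ≤
      ENNReal.ofReal (‖H (truncate φ M a) - (E : ℂ) • truncate φ M a‖ ^ 2) := by
    intro a
    rw [← ENNReal.ofReal_mul (by positivity)]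
    apply ENNReal.ofReal_le_ofReal
    rw [← mul_pow]
    apply pow_le_pow_left₀ (by positivity)
    by_cases h0 : truncate φ M a = 0
    · simp [h0]
    · refine (hcon a (truncate φ M a) ?_ h0).le
      intro n hn
      rw [truncate_apply, if_neg (fun h => absurd (hn h.1) (not_le.mpr h.2))]
  have hsum := (ENNReal.tsum_le_tsum hlow).trans (sum_truncate_image_le 𝔭 𝔮 ω H hH E φ M)
  rw [ENNReal.tsum_mul_left, sum_truncate, ← ENNReal.ofReal_natCast,
    ← ENNReal.ofReal_mul (by positivity), ← ENNReal.ofReal_mul (by positivity),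
    ENNReal.ofReal_le_ofReal_iff (by positivity)] at hsum
  have hφp : 0 < ‖φ‖ ^ 2 := by
    have : 0 < ‖φ‖ := norm_pos_iff.mpr hφ0
    positivity
  have h2 : ‖H φ - (E : ℂ) • φ‖ ^ 2 ≤ (ε / 4 * ‖φ‖) ^ 2 :=
    pow_le_pow_left₀ (norm_nonneg _) hφ 2
  have h3 : (M : ℝ) * ‖H φ - (E : ℂ) • φ‖ ^ 2 ≤ M * (ε / 4 * ‖φ‖) ^ 2 := by gcongr
  have h4 : 40 * (1 + |𝔭|) ^ 2 * ‖φ‖ ^ 2 < M * ε ^ 2 * ‖φ‖ ^ 2 := by gcongr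
  nlinarith [mul_nonneg (mul_nonneg (Nat.cast_nonneg (α := ℝ) M) (sq_nonneg ε)) hφp.le]

theorem spectrum_near_of_windows (𝔭 𝔮 : ℝ) (ε : ℝ) (hε : 0 < ε) :
    ∃ L : ℕ, ∀ (ω ω' : ℤ → Bool) (H H' : JacobiSpace →L[ℂ] JacobiSpace),
      IsJacobi 𝔭 𝔮 ω H → IsJacobi 𝔭 𝔮 ω' H' →
      (∀ a : ℤ, ∃ b : ℤ, ∀ i : ℕ, i < L → ω' (b + i) = ω (a + i)) →
      ∀ E : ℝ, (E : ℂ) ∈ spectrum ℂ H →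
        ∃ E' : ℝ, (E' : ℂ) ∈ spectrum ℂ H' ∧ |E - E'| ≤ ε := by
  obtain ⟨M, hM⟩ := exists_localized 𝔭 𝔮 ε hε
  refine ⟨M + 1, fun ω ω' H H' hH hH' hw E hE => ?_⟩
  obtain ⟨a, ψ, hsupp, hψ0, hψ⟩ := hM ω H hH E hE
  obtain ⟨b, hb⟩ := hw a
  have hb' : ∀ n : ℤ, a ≤ n + (a - b) → n + (a - b) ≤ a + M → ω' n = ω (n + (a - b)) := by
    intro n h1 h2
    have := hb (n - b).toNat (by omega)
    rw [Int.toNat_of_nonneg (by omega)] at this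
    rw [show n = b + (n - b) by ring, this]
    congr 1
    ring
  have hshift : ∀ x : JacobiSpace, Summable
      (fun n : ℤ => ‖(x : ∀ _ : ℤ, ℂ) (n + (a - b))‖ ^ 2) := fun x =>
    ((Equiv.addRight (a - b)).summable_iff).mpr (jacobiSpace_summable_sq x)
  have hnorm : ∀ x y : JacobiSpace,
      (∀ n : ℤ, (y : ∀ _ : ℤ, ℂ) n = (x : ∀ _ : ℤ, ℂ) (n + (a - b))) → ‖y‖ = ‖x‖ := by
    intro x y hxy
    have h1 : ‖y‖ ^ 2 = ‖x‖ ^ 2 := by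
      rw [jacobiSpace_norm_sq, jacobiSpace_norm_sq]
      simp_rw [hxy]
      exact (Equiv.addRight (a - b)).tsum_eq (fun n => ‖(x : ∀ _ : ℤ, ℂ) n‖ ^ 2)
    exact (pow_left_inj₀ (norm_nonneg _) (norm_nonneg _) two_ne_zero).mp h1
  set ψ' : JacobiSpace := ⟨fun n => (ψ : ∀ _ : ℤ, ℂ) (n + (a - b)),
    jacobiSpace_mem _ (hshift ψ)⟩ with hψ'
  have hψ'n : ∀ n : ℤ, (ψ' : ∀ _ : ℤ, ℂ) n = (ψ : ∀ _ : ℤ, ℂ) (n + (a - b)) := fun n => rfl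
  have hn1 : ‖ψ'‖ = ‖ψ‖ := hnorm ψ ψ' hψ'n
  have hn2 : ‖H' ψ' - (E : ℂ) • ψ'‖ = ‖H ψ - (E : ℂ) • ψ‖ := by
    apply hnorm
    intro n
    simp only [lp.coeFn_sub, lp.coeFn_smul, Pi.sub_apply, Pi.smul_apply, smul_eq_mul, hH _ _,
      hH' _ _, hψ'n]
    rw [show n + 1 + (a - b) = n + (a - b) + 1 by ring,
      show n - 1 + (a - b) = n + (a - b) - 1 by ring]
    have c1 : (pCoef 𝔭 (ω' (n + 1)) : ℂ) * (ψ : ∀ _ : ℤ, ℂ) (n + (a - b) + 1)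
        = (pCoef 𝔭 (ω (n + (a - b) + 1)) : ℂ) * (ψ : ∀ _ : ℤ, ℂ) (n + (a - b) + 1) := by
      by_cases h : a ≤ n + (a - b) + 1 ∧ n + (a - b) + 1 < a + M
      · rw [hb' (n + 1) (by omega) (by omega), show n + 1 + (a - b) = n + (a - b) + 1 by ring]
      · rw [hsupp _ h]; simp
    have c2 : (pCoef 𝔭 (ω' n) : ℂ) * (ψ : ∀ _ : ℤ, ℂ) (n + (a - b) - 1)
        = (pCoef 𝔭 (ω (n + (a - b))) : ℂ) * (ψ : ∀ _ : ℤ, ℂ) (n + (a - b) - 1) := by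
      by_cases h : a ≤ n + (a - b) - 1 ∧ n + (a - b) - 1 < a + M
      · rw [hb' n (by omega) (by omega)]
      · rw [hsupp _ h]; simp
    have c3 : (qCoef 𝔮 (ω' n) : ℂ) * (ψ : ∀ _ : ℤ, ℂ) (n + (a - b))
        = (qCoef 𝔮 (ω (n + (a - b))) : ℂ) * (ψ : ∀ _ : ℤ, ℂ) (n + (a - b)) := by
      by_cases h : a ≤ n + (a - b) ∧ n + (a - b) < a + M
      · rw [hb' n (by omega) (by omega)]
      · rw [hsupp _ h]; simp
    rw [c1, c2, c3]
  refine exists_spectrum_near H' (isJacobi_isSelfAdjoint 𝔭 𝔮 ω' H' hH') E ε hε ψ' ?_ ?_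
  · rw [← norm_ne_zero_iff, hn1, norm_ne_zero_iff]
    exact hψ0
  · rw [hn1, hn2]
    exact hψ

end JacobiOperators

section Words

/-- The word of length `n` read off `v` at position `A`. -/
def factorAt (v : ℤ → Bool) (A : ℤ) (n : ℕ) : List Bool :=
  (List.range n).map (fun i : ℕ => v (A + i))

theorem factorAt_length (v : ℤ → Bool) (A : ℤ) (n : ℕ) : (factorAt v A n).length = n := by
  simp [factorAt]

theorem factorAt_succ (v : ℤ → Bool) (A : ℤ) (n : ℕ) :
    factorAt v A (n + 1) = factorAt v A n ++ [v (A + n)] := by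
  simp [factorAt, List.range_succ]

theorem factorAt_add (v : ℤ → Bool) (A : ℤ) (m n : ℕ) :
    factorAt v A (m + n) = factorAt v A m ++ factorAt v (A + m) n := by
  induction n with
  | zero => simp [factorAt]
  | succ n ih =>
    rw [← add_assoc, factorAt_succ, ih, factorAt_succ, List.append_assoc]
    push_cast
    rw [add_assoc]

theorem factorAt_getD (v : ℤ → Bool) (A : ℤ) (n i : ℕ) (hi : i < n) :
    (factorAt v A n).getD i false = v (A + i) := by
  simp [factorAt, List.getD, hi]

theorem eq_factorAt_of_append (v : ℤ → Bool) (A : ℤ) (n : ℕ) (u w : List Bool)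
    (h : u ++ w = factorAt v A n) : w = factorAt v (A + u.length) w.length := by
  have hn : n = u.length + w.length := by
    have := congrArg List.length h
    rw [factorAt_length, List.length_append] at this
    exact this.symm
  rw [hn, factorAt_add] at h
  exact (List.append_inj h (by rw [factorAt_length])).2

/-- Discrepancy of a word with respect to the frequency `α`. -/
noncomputable def disc (α : ℝ) (w : List Bool) : ℝ := (w.count true : ℝ) - α * w.length

theorem disc_append (α : ℝ) (u w : List Bool) : disc α (u ++ w) = disc α u + disc α w := by
  simp only [disc, List.count_append, List.length_append]
  push_cast
  ring

theorem count_false_add (w : List Bool) : (w.count false : ℝ) + w.count true = w.length := by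
  have := List.count_false_add_count_true w
  exact_mod_cast this

theorem disc_applySubst (α : ℝ) (s : Bool → List Bool) (w : List Bool) :
    disc α (applySubst s w)
      = w.length * disc α (s false) + w.count true * (disc α (s true) - disc α (s false)) := by
  induction w with
  | nil => simp [applySubst, disc]
  | cons b w ih =>
    have : applySubst s (b :: w) = s b ++ applySubst s w := by simp [applySubst]
    rw [this, disc_append, ih]
    cases b
    · simp
      ring
    · simp
      ring

theorem applySubst_append (s : Bool → List Bool) (u w : List Bool) :
    applySubst s (u ++ w) = applySubst s u ++ applySubst s w := by
  simp [applySubst]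

theorem iterate_append (s : Bool → List Bool) (k : ℕ) (u w : List Bool) :
    (applySubst s)^[k] (u ++ w) = (applySubst s)^[k] u ++ (applySubst s)^[k] w := by
  induction k with
  | zero => rfl
  | succ k ih => rw [Function.iterate_succ_apply', ih, applySubst_append,
      Function.iterate_succ_apply', Function.iterate_succ_apply']

theorem substPow_eq_iterate (s : Bool → List Bool) (k : ℕ) (b : Bool) :
    substPow s k b = (applySubst s)^[k] [b] := by
  induction k with
  | zero => rfl
  | succ k ih => rw [Function.iterate_succ_apply', ← ih]; rfl

theorem substPow_add (s : Bool → List Bool) (k l : ℕ) (b : Bool) :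
    substPow s (k + l) b = (applySubst s)^[k] (substPow s l b) := by
  rw [substPow_eq_iterate, substPow_eq_iterate, Function.iterate_add_apply]

theorem fixed_prefix (s : Bool → List Bool) (v : ℤ → Bool)
    (hfix : FixedPointOfSubst s (fun n : ℕ => v (n : ℤ))) (n : ℕ) :
    applySubst s (factorAt v 0 n) = factorAt v 0 (applySubst s (factorAt v 0 n)).length := by
  apply List.ext_getElem
  · rw [factorAt_length]
  · intro i h1 h2
    have e : factorAt v 0 n = (List.range n).map (fun n : ℕ => v (n : ℤ)) := by simp [factorAt]
    have := hfix n i (by rw [← e]; exact h1)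
    simp only [List.get_eq_getElem, ← e] at this
    rw [this]
    simp [factorAt]

theorem fixed_prefix_iterate (s : Bool → List Bool) (v : ℤ → Bool)
    (hfix : FixedPointOfSubst s (fun n : ℕ => v (n : ℤ))) (n k : ℕ) :
    (applySubst s)^[k] (factorAt v 0 n)
      = factorAt v 0 ((applySubst s)^[k] (factorAt v 0 n)).length := by
  induction k with
  | zero => simp [factorAt_length]
  | succ k ih =>
    rw [Function.iterate_succ_apply', ih]
    exact fixed_prefix s v hfix _

end Words

section Coding

theorem coding_step (v : ℤ → Bool) (α β : ℝ) (hα : α ∈ Set.Ioo (0 : ℝ) 1)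
    (hv : ∀ n : ℤ, (v n = true ↔ Int.fract ((n : ℝ) * α + β) ∈ Set.Ico (1 - α) 1)) (n : ℤ) :
    ⌊β + ((n + 1 : ℤ) : ℝ) * α⌋ = ⌊β + (n : ℝ) * α⌋ + (if v n = true then 1 else 0) := by
  obtain ⟨h0, h1⟩ := hα
  have hn := hv n
  rw [add_comm, Set.mem_Ico] at hn
  have hf := Int.floor_add_fract (β + (n : ℝ) * α)
  have hf0 := Int.fract_nonneg (β + (n : ℝ) * α)
  have hf1 := Int.fract_lt_one (β + (n : ℝ) * α)
  rw [Int.floor_eq_iff]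
  by_cases hb : v n = true
  · rw [if_pos hb]
    have := hn.mp hb
    push_cast
    constructor <;> linarith
  · rw [if_neg hb]
    have h2 : Int.fract (β + (n : ℝ) * α) < 1 - α := by
      by_contra h
      exact hb (hn.mpr ⟨not_lt.mp h, hf1⟩)
    push_cast
    constructor <;> linarith

theorem count_factorAt (v : ℤ → Bool) (α β : ℝ)
    (hG : ∀ n : ℤ, ⌊β + ((n + 1 : ℤ) : ℝ) * α⌋ = ⌊β + (n : ℝ) * α⌋ + (if v n = true then 1 else 0))
    (A : ℤ) (n : ℕ) :
    ((factorAt v A n).count true : ℤ) = ⌊β + ((A + n : ℤ) : ℝ) * α⌋ - ⌊β + (A : ℝ) * α⌋ := by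
  induction n with
  | zero => simp [factorAt]
  | succ n ih =>
    rw [factorAt_succ, List.count_append]
    have := hG (A + n)
    push_cast at this ih ⊢
    rw [← add_assoc (A : ℝ) (n : ℝ) 1, this, ih]
    cases v (A + n) <;> simp
    ring

theorem disc_factorAt_abs_le (v : ℤ → Bool) (α β : ℝ)
    (hG : ∀ n : ℤ, ⌊β + ((n + 1 : ℤ) : ℝ) * α⌋ = ⌊β + (n : ℝ) * α⌋ + (if v n = true then 1 else 0))
    (A : ℤ) (n : ℕ) : |disc α (factorAt v A n)| ≤ 1 := by
  have h := count_factorAt v α β hG A n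
  have h' : ((factorAt v A n).count true : ℝ)
      = (⌊β + ((A + n : ℤ) : ℝ) * α⌋ : ℝ) - ⌊β + (A : ℝ) * α⌋ := by exact_mod_cast h
  rw [disc, h', factorAt_length]
  have a1 := Int.floor_le (β + ((A + n : ℤ) : ℝ) * α)
  have a2 := Int.lt_floor_add_one (β + ((A + n : ℤ) : ℝ) * α)
  have b1 := Int.floor_le (β + (A : ℝ) * α)
  have b2 := Int.lt_floor_add_one (β + (A : ℝ) * α)
  push_cast at *
  rw [abs_le]
  constructor <;> linarith

theorem letter_eq_of_floor (v : ℤ → Bool) (α β : ℝ)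
    (hG : ∀ n : ℤ, ⌊β + ((n + 1 : ℤ) : ℝ) * α⌋ = ⌊β + (n : ℝ) * α⌋ + (if v n = true then 1 else 0))
    (m n c : ℤ) (h0 : ⌊β + (m : ℝ) * α⌋ = ⌊β + (n : ℝ) * α⌋ + c)
    (h1 : ⌊β + ((m + 1 : ℤ) : ℝ) * α⌋ = ⌊β + ((n + 1 : ℤ) : ℝ) * α⌋ + c) : v m = v n := by
  rw [hG m, hG n, h0] at h1
  revert h1
  cases v m <;> cases v n <;> simp

theorem irrational_lin_zero (α : ℝ) (hα : Irrational α) (a b : ℤ) (h : (a : ℝ) = α * b) :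
    a = 0 ∧ b = 0 := by
  have hb : b = 0 := by
    by_contra hb
    exact (hα.mul_intCast hb).ne_int a h.symm
  refine ⟨?_, hb⟩
  rw [hb] at h
  simpa using h

theorem eventually_floor_eq (x : ℝ) (hx : ∀ m : ℤ, x ≠ m) (η : ℕ → ℝ)
    (hη : Tendsto η atTop (𝓝 0)) : ∀ᶠ k in atTop, ⌊x + η k⌋ = ⌊x⌋ := by
  have h1 : Tendsto (fun k => x + η k) atTop (𝓝 x) := by simpa using hη.const_add x
  have h2 : Set.Ioo (⌊x⌋ : ℝ) (⌊x⌋ + 1) ∈ 𝓝 x :=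
    Ioo_mem_nhds (lt_of_le_of_ne (Int.floor_le x) (hx _).symm) (Int.lt_floor_add_one x)
  filter_upwards [h1 h2] with k hk
  rw [Int.floor_eq_iff]
  exact ⟨hk.1.le, hk.2⟩

theorem eventually_floor_eq_right (x : ℝ) (η : ℕ → ℝ) (h0 : ∀ k, 0 ≤ η k)
    (hη : Tendsto η atTop (𝓝 0)) : ∀ᶠ k in atTop, ⌊x + η k⌋ = ⌊x⌋ := by
  have h1 : Tendsto (fun k => x + η k) atTop (𝓝 x) := by simpa using hη.const_add x
  have h2 : Set.Iio ((⌊x⌋ : ℝ) + 1) ∈ 𝓝 x := Iio_mem_nhds (Int.lt_floor_add_one x)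
  filter_upwards [h1 h2] with k hk
  rw [Int.floor_eq_iff]
  exact ⟨by linarith [Int.floor_le x, h0 k], hk⟩

/-- The contraction factor of the discrepancy under a substitution with a Sturmian fixed point. -/
theorem exists_multiplier (s : Bool → List Bool) (v : ℤ → Bool) (hv : IsSubstSeqOf s v)
    (α β : ℝ) (hα : Irrational α) (hα1 : α ∈ Set.Ioo (0 : ℝ) 1)
    (hG : ∀ n : ℤ, ⌊β + ((n + 1 : ℤ) : ℝ) * α⌋ = ⌊β + (n : ℝ) * α⌋ + (if v n = true then 1 else 0)) :
    ∃ μ : ℝ, |μ| < 1 ∧ μ ≠ 0 ∧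
      ∀ k : ℕ, ∀ w : List Bool, disc α ((applySubst s)^[k] w) = μ ^ k * disc α w := by
  obtain ⟨⟨⟨k0, hprim⟩, -⟩, hhead, hfix, -⟩ := hv
  obtain ⟨hα0, hαlt⟩ := hα1
  set a := disc α (s false) with ha
  set μ := disc α (s true) - disc α (s false) with hμ
  have hlin : a + α * μ = 0 := by
    by_contra hne
    have hpos : 0 < |a + α * μ| := abs_pos.mpr hne
    obtain ⟨n, hn⟩ := exists_nat_gt ((1 + |μ|) / |a + α * μ|)
    rw [div_lt_iff₀ hpos] at hn
    have h1 := disc_factorAt_abs_le v α β hG 0 n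
    have h2 := disc_factorAt_abs_le v α β hG 0 (applySubst s (factorAt v 0 n)).length
    rw [← fixed_prefix s v hfix n, disc_applySubst] at h2
    have h3 : ((factorAt v 0 n).count true : ℝ) = disc α (factorAt v 0 n) + α * n := by
      rw [disc, factorAt_length]; ring
    rw [h3, factorAt_length] at h2
    have h4 : (n : ℝ) * a + (disc α (factorAt v 0 n) + α * n) * μ
        = n * (a + α * μ) + disc α (factorAt v 0 n) * μ := by ring
    rw [← ha, ← hμ, h4] at h2
    have h5 : |(n : ℝ) * (a + α * μ)| ≤ 1 + |μ| := by
      have h6 : (n : ℝ) * (a + α * μ) = (n * (a + α * μ) + disc α (factorAt v 0 n) * μ)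
        - disc α (factorAt v 0 n) * μ := by ring
      rw [h6]
      refine (abs_sub _ _).trans ?_
      rw [abs_mul]
      nlinarith [abs_nonneg μ]
    rw [abs_mul, Nat.abs_cast] at h5
    linarith
  have hstep : ∀ w : List Bool, disc α (applySubst s w) = μ * disc α w := by
    intro w
    rw [disc_applySubst, ← ha, ← hμ, disc]
    have : a = -(α * μ) := by linarith
    rw [this]
    ring
  have hiter : ∀ k : ℕ, ∀ w : List Bool,
      disc α ((applySubst s)^[k] w) = μ ^ k * disc α w := by
    intro k w
    induction k with
    | zero => simp
    | succ k ih => rw [Function.iterate_succ_apply', hstep, ih]; ring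
  have hsf : (s false).count true - α * (s false).length = -(α * μ) := by
    have : disc α (s false) = -(α * μ) := by rw [← ha]; linarith
    rw [← this, disc]
  have hne : s false ≠ [] := by
    intro h
    rw [h] at hhead
    simp at hhead
  have hlen : 0 < (s false).length := List.length_pos_iff.mpr hne
  have hle : |μ| ≤ 1 := by
    by_contra hgt
    push Not at hgt
    have hD : 0 < |disc α (factorAt v 0 1)| := by
      have : disc α (factorAt v 0 1) ≠ 0 := by
        simp only [factorAt, disc]
        cases hv0 : v 0 <;> simp [hv0] <;> intro h <;> linarith
      exact abs_pos.mpr this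
    obtain ⟨k, hk⟩ := pow_unbounded_of_one_lt (1 / |disc α (factorAt v 0 1)|) hgt
    rw [div_lt_iff₀ hD] at hk
    have h1 := disc_factorAt_abs_le v α β hG 0 ((applySubst s)^[k] (factorAt v 0 1)).length
    rw [← fixed_prefix_iterate s v hfix 1 k, hiter, abs_mul, abs_pow] at h1
    linarith
  refine ⟨μ, lt_of_le_of_ne hle ?_, ?_, hiter⟩
  · intro h
    rcases (abs_eq (by norm_num)).mp h with h | h
    · rw [h] at hsf
      have h2 := irrational_lin_zero α hα ((s false).count true) ((s false).length - 1)
        (by push_cast; linarith)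
      have h3 : (s false).length = 1 := by omega
      obtain ⟨b, hb⟩ := List.length_eq_one_iff.mp h3
      have hbf : s false = [false] := by
        rw [hb] at hhead ⊢
        simpa using hhead
      have hall : ∀ k, substPow s k false = [false] := by
        intro k
        induction k with
        | zero => rfl
        | succ k ih => simp [substPow, ih, applySubst, hbf]
      have := hprim false true
      rw [hall] at this
      simp at this
    · rw [h] at hsf
      have h2 := irrational_lin_zero α hα ((s false).count true) ((s false).length + 1)
        (by push_cast; linarith)
      omega
  · intro h
    rw [h] at hsf
    have h2 := irrational_lin_zero α hα ((s false).count true) ((s false).length)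
        (by push_cast; linarith)
    omega

theorem eventually_length_ge (α : ℝ) (hα1 : α ∈ Set.Ioo (0 : ℝ) 1) (s : Bool → List Bool) (μ : ℝ)
    (h1 : |μ| < 1) (h0 : μ ≠ 0)
    (hμ : ∀ k : ℕ, ∀ w : List Bool, disc α ((applySubst s)^[k] w) = μ ^ k * disc α w)
    (b : Bool) (N : ℕ) : ∀ᶠ k in atTop, N ≤ (substPow s k b).length := by
  obtain ⟨hα0, hαlt⟩ := hα1
  have hD : disc α [b] ≠ 0 := by
    cases b <;> simp [disc] <;> intro h <;> linarith
  have ht : Tendsto (fun k => μ ^ k * disc α [b]) atTop (𝓝 0) := by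
    have := (tendsto_pow_atTop_nhds_zero_of_abs_lt_one h1).mul_const (disc α [b])
    simpa using this
  have hev : ∀ y : ℝ, ∀ᶠ k in atTop, μ ^ k * disc α [b] ≠ y := by
    intro y
    by_cases hy : y = 0
    · rw [hy]
      exact Eventually.of_forall fun k => mul_ne_zero (pow_ne_zero k h0) hD
    · exact ht.eventually_ne (Ne.symm hy)
  have hfin : ∀ᶠ k in atTop, ∀ p ∈ (Finset.range N ×ˢ Finset.range N : Finset (ℕ × ℕ)),
      μ ^ k * disc α [b] ≠ (p.2 : ℝ) - α * p.1 := by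
    rw [Filter.eventually_all_finset]
    intro p _
    exact hev _
  filter_upwards [hfin] with k hk
  by_contra hlt
  push Not at hlt
  refine hk ((substPow s k b).length, (substPow s k b).count true) ?_ ?_
  · rw [Finset.mem_product, Finset.mem_range, Finset.mem_range]
    exact ⟨hlt, lt_of_le_of_lt List.count_le_length hlt⟩
  · rw [← hμ, ← substPow_eq_iterate, disc]

end Coding

section Windows

theorem periodicSeq_add_mul (w : List Bool) (n q : ℤ) :
    periodicSeq w (n + q * w.length) = periodicSeq w n := by
  simp [periodicSeq]

theorem periodicSeq_factorAt (v : ℤ → Bool) (A : ℤ) (n : ℕ) (r : ℤ) (h0 : 0 ≤ r) (h1 : r < n) :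
    periodicSeq (factorAt v A n) r = v (A + r) := by
  rw [periodicSeq, factorAt_length, Int.emod_eq_of_lt h0 h1, factorAt_getD _ _ _ _ (by omega),
    Int.toNat_of_nonneg h0]

theorem windows_of_sequence (s : Bool → List Bool) (v : ℤ → Bool) (hv : IsSubstSeqOf s v)
    (L : ℕ) : ∀ᶠ k in atTop, ∀ a : ℤ, ∃ b : ℤ, ∀ i : ℕ, i < L →
      periodicSeq (substPow s k false) (b + i) = v (a + i) := by
  have hv' := hv
  obtain ⟨⟨⟨k0, hprim⟩, -⟩, hhead, hfix, α, β, hα, hα1, hcode⟩ := hv'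
  have hG := coding_step v α β hα1 hcode
  obtain ⟨μ, hμ1, hμ0, hμ⟩ := exists_multiplier s v hv α β hα hα1 hG
  -- recurrence: each window occurs at a nonnegative position
  have hrec : ∀ a : ℤ, ∃ m : ℕ, ∀ i : ℕ, i < L → v (m + i) = v (a + i) := by
    intro a
    have hsq : Tendsto (fun k : ℕ => 2 * k) atTop atTop :=
      tendsto_id.const_mul_atTop' (by norm_num)
    have hηt : Tendsto (fun k : ℕ => α * μ ^ (2 * k)) atTop (𝓝 0) := by
      have := ((tendsto_pow_atTop_nhds_zero_of_abs_lt_one hμ1).comp hsq).const_mul α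
      simpa using this
    have hη0 : ∀ k : ℕ, 0 ≤ α * μ ^ (2 * k) := by
      intro k
      rw [pow_mul]
      exact mul_nonneg hα1.1.le (pow_nonneg (sq_nonneg μ) k)
    have hfl : ∀ᶠ k : ℕ in atTop, ∀ i ∈ Finset.range (L + 1),
        ⌊(β + ((a + i : ℤ) : ℝ) * α) + α * μ ^ (2 * k)⌋ = ⌊β + ((a + i : ℤ) : ℝ) * α⌋ := by
      rw [Filter.eventually_all_finset]
      intro i _
      exact eventually_floor_eq_right _ _ hη0 hηt
    have hlen := hsq.eventually
      (eventually_length_ge α hα1 s μ hμ1 hμ0 hμ false a.natAbs)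
    obtain ⟨k, hk1, hk2⟩ := (hfl.and hlen).exists
    set w := substPow s (2 * k) false with hw
    have hd : disc α w = -(α * μ ^ (2 * k)) := by
      rw [hw, substPow_eq_iterate, hμ]
      simp [disc]
      ring
    have hnα : (w.length : ℝ) * α = (w.count true : ℤ) + α * μ ^ (2 * k) := by
      rw [disc] at hd
      push_cast
      linarith
    have hshift : ∀ i ∈ Finset.range (L + 1), ⌊β + ((a + w.length + i : ℤ) : ℝ) * α⌋
        = ⌊β + ((a + i : ℤ) : ℝ) * α⌋ + (w.count true : ℤ) := by
      intro i hi
      rw [← hk1 i hi, ← Int.floor_add_intCast]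
      congr 1
      push_cast at hnα ⊢
      linarith
    refine ⟨(a + w.length).toNat, fun i hi => ?_⟩
    rw [Int.toNat_of_nonneg (by omega)]
    apply letter_eq_of_floor v α β hG _ _ (w.count true : ℤ)
    · exact hshift i (by rw [Finset.mem_range]; omega)
    · have := hshift (i + 1) (by rw [Finset.mem_range]; omega)
      push_cast at this ⊢
      simpa only [add_assoc] using this
  -- uniform bound over the finitely many patterns
  have hpat : ∀ f : Fin L → Bool, ∃ m : ℕ, (∃ a : ℤ, ∀ i : Fin L, v (a + (i : ℕ)) = f i) →
      ∀ i : Fin L, v (m + (i : ℕ)) = f i := by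
    intro f
    by_cases h : ∃ a : ℤ, ∀ i : Fin L, v (a + (i : ℕ)) = f i
    · obtain ⟨a, ha⟩ := h
      obtain ⟨m, hm⟩ := hrec a
      exact ⟨m, fun _ i => by rw [hm i i.2, ha]⟩
    · exact ⟨0, fun h' => absurd h' h⟩
  choose m hm using hpat
  set B : ℕ := Finset.univ.sup m with hB
  have hlen := eventually_length_ge α hα1 s μ hμ1 hμ0 hμ (v 0) (B + L)
  obtain ⟨K, hK⟩ := eventually_atTop.mp hlen
  filter_upwards [eventually_ge_atTop (K + k0)] with k hk a
  obtain ⟨j, rfl⟩ : ∃ j, k = j + k0 := ⟨k - k0, by omega⟩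
  have hj := hK j (by omega)
  obtain ⟨l1, l2, hl⟩ := List.append_of_mem (hprim false (v 0))
  have e1 : substPow s (j + k0) false
      = (applySubst s)^[j] l1 ++ (substPow s j (v 0) ++ (applySubst s)^[j] l2) := by
    rw [substPow_add, hl, iterate_append, show v 0 :: l2 = [v 0] ++ l2 from rfl, iterate_append,
      substPow_eq_iterate]
  have e2 : substPow s j (v 0) = factorAt v 0 (substPow s j (v 0)).length := by
    have h1 : [v 0] = factorAt v 0 1 := by simp [factorAt]
    rw [substPow_eq_iterate, h1]
    exact fixed_prefix_iterate s v hfix 1 j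
  set l1' := (applySubst s)^[j] l1 with hl1'
  set l2' := (applySubst s)^[j] l2 with hl2'
  set u := substPow s j (v 0) with hu
  set f : Fin L → Bool := fun i => v (a + (i : ℕ)) with hf
  have hmf := hm f ⟨a, fun i => rfl⟩
  have hmB : m f ≤ B := Finset.le_sup (Finset.mem_univ f)
  refine ⟨(l1'.length + m f : ℕ), fun i hi => ?_⟩
  have hmi := hmf ⟨i, hi⟩
  simp only [hf] at hmi
  rw [← hmi, e1, periodicSeq, Int.emod_eq_of_lt (by omega)
    (by rw [List.length_append, List.length_append]; push_cast; omega)]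
  rw [show (((l1'.length + m f : ℕ) : ℤ) + (i : ℤ)).toNat = l1'.length + (m f + i) by omega]
  rw [List.getD_append_right _ _ _ _ (by omega), Nat.add_sub_cancel_left,
    List.getD_append _ _ _ _ (by omega), e2, factorAt_getD _ _ _ _ (by omega)]
  push_cast
  rw [zero_add]

theorem windows_of_periodic (s : Bool → List Bool) (v : ℤ → Bool) (hv : IsSubstSeqOf s v)
    (L : ℕ) : ∀ᶠ k in atTop, ∀ a : ℤ, ∃ b : ℤ, ∀ i : ℕ, i < L →
      v (b + i) = periodicSeq (substPow s k false) (a + i) := by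
  have hv' := hv
  obtain ⟨⟨⟨k0, hprim⟩, -⟩, hhead, hfix, α, β, hα, hα1, hcode⟩ := hv'
  have hG := coding_step v α β hα1 hcode
  obtain ⟨μ, hμ1, hμ0, hμ⟩ := exists_multiplier s v hv α β hα hα1 hG
  -- an occurrence of the letter `0`
  obtain ⟨j, hj⟩ : ∃ j : ℕ, v j = false := by
    have h1 : [v 0] = factorAt v 0 1 := by simp [factorAt]
    have h2 := hprim (v 0) false
    rw [substPow_eq_iterate, h1, fixed_prefix_iterate s v hfix 1 k0] at h2
    simp only [factorAt, List.mem_map] at h2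
    obtain ⟨j, -, hj⟩ := h2
    exact ⟨j, by simpa using hj⟩
  set d := disc α (factorAt v 0 j) with hd
  set A : ℕ → ℕ := fun k => ((applySubst s)^[k] (factorAt v 0 j)).length with hA
  set Cn : ℕ → ℤ := fun k => ((applySubst s)^[k] (factorAt v 0 j)).count true with hCn
  set n : ℕ → ℕ := fun k => (substPow s k false).length with hn
  set c : ℕ → ℤ := fun k => (substPow s k false).count true with hc
  have hocc : ∀ k, substPow s k false = factorAt v (A k) (n k) := by
    intro k
    have h1 := fixed_prefix_iterate s v hfix (j + 1) k
    rw [factorAt_succ, zero_add, hj, iterate_append, ← substPow_eq_iterate] at h1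
    have h2 := eq_factorAt_of_append v 0 _ _ _ h1
    rw [zero_add] at h2
    exact h2
  have hAα : ∀ k, (A k : ℝ) * α = Cn k - μ ^ k * d := by
    intro k
    have := hμ k (factorAt v 0 j)
    rw [disc] at this
    simp only [hA, hCn]
    push_cast
    linarith
  have hnα : ∀ k, (n k : ℝ) * α = c k + α * μ ^ k := by
    intro k
    have := hμ k [false]
    rw [← substPow_eq_iterate, disc] at this
    simp [disc] at this
    simp only [hn, hc]
    push_cast
    linarith
  set η : ℕ → ℝ := fun k => - (μ ^ k * d) with hη
  set η' : ℕ → ℝ := fun k => - (μ ^ k * d) + α * μ ^ k with hη'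
  have hp := tendsto_pow_atTop_nhds_zero_of_abs_lt_one hμ1
  have hηt : Tendsto η atTop (𝓝 0) := by
    have := (hp.mul_const d).neg
    simpa using this
  have hηt' : Tendsto η' atTop (𝓝 0) := by
    have := ((hp.mul_const d).neg).add (hp.const_mul α)
    simpa using this
  have hfA : ∀ k (t : ℤ), ⌊β + ((A k + t : ℤ) : ℝ) * α⌋ = ⌊(β + t * α) + η k⌋ + Cn k := by
    intro k t
    rw [← Int.floor_add_intCast]
    congr 1
    have := hAα k
    simp only [hη]
    push_cast
    linarith
  have hfAn : ∀ k (t : ℤ), ⌊β + ((A k + n k + t : ℤ) : ℝ) * α⌋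
      = ⌊(β + t * α) + η' k⌋ + Cn k + c k := by
    intro k t
    rw [← Int.floor_add_intCast, ← Int.floor_add_intCast]
    congr 1
    have := hAα k
    have := hnα k
    simp only [hη']
    push_cast
    linarith
  -- if the two floors agree at `t` and `t + 1` then the letters agree
  have hlet : ∀ k (t : ℤ), ⌊(β + t * α) + η' k⌋ = ⌊(β + t * α) + η k⌋ →
      ⌊(β + (t + 1 : ℤ) * α) + η' k⌋ = ⌊(β + (t + 1 : ℤ) * α) + η k⌋ →
      v (A k + n k + t) = v (A k + t) := by
    intro k t h1 h2
    apply letter_eq_of_floor v α β hG _ _ (c k)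
    · rw [hfAn, hfA, h1]
    · rw [add_assoc _ t 1, hfAn, add_assoc _ t 1, hfA, h2]
  have hzero : ∀ k, ⌊(β + (0 : ℤ) * α) + η' k⌋ = ⌊(β + (0 : ℤ) * α) + η k⌋ := by
    intro k
    have h1 := count_factorAt v α β hG (A k) (n k)
    rw [← hocc k] at h1
    have h2 := hfA k 0
    have h3 := hfAn k 0
    rw [add_zero] at h2 h3
    have h4 : ((substPow s k false).count true : ℤ) = c k := rfl
    have h5 : (((A k : ℕ) : ℤ) : ℝ) = ((A k : ℤ) : ℝ) := rfl
    rw [h3, h4, h2] at h1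
    linarith
  have hnonint : ∀ t : ℤ, (∀ m : ℤ, β + t * α ≠ m) →
      ∀ᶠ k in atTop, ⌊(β + t * α) + η' k⌋ = ⌊(β + t * α) + η k⌋ := by
    intro t ht
    filter_upwards [eventually_floor_eq _ ht η hηt, eventually_floor_eq _ ht η' hηt'] with k h1 h2
    rw [h1, h2]
  have hlen : ∀ᶠ k in atTop, L + 1 ≤ n k := eventually_length_ge α hα1 s μ hμ1 hμ0 hμ false (L + 1)
  have hper : ∀ k (a : ℤ) (i : ℕ), L + 1 ≤ n k → i < L →
      periodicSeq (substPow s k false) (a + i) =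
        if a % (n k : ℤ) + i < n k then v (A k + (a % (n k : ℤ) + i))
        else v (A k + (a % (n k : ℤ) + i - n k)) := by
    intro k a i hk hi
    have hr0 : 0 ≤ a % (n k : ℤ) := Int.emod_nonneg _ (by omega)
    have hr1 : a % (n k : ℤ) < n k := Int.emod_lt_of_pos _ (by omega)
    have hdiv := Int.emod_add_mul_ediv a (n k)
    have hlenk : ((substPow s k false).length : ℤ) = n k := rfl
    split_ifs with h
    · rw [show a + i = (a % (n k : ℤ) + i) + (a / (n k : ℤ)) * (substPow s k false).length by
        rw [hlenk]; linarith, periodicSeq_add_mul, hocc k,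
        periodicSeq_factorAt _ _ _ _ (by omega) h]
    · rw [show a + i = (a % (n k : ℤ) + i - n k)
          + (a / (n k : ℤ) + 1) * (substPow s k false).length by
        rw [hlenk]; linarith, periodicSeq_add_mul, hocc k,
        periodicSeq_factorAt _ _ _ _ (by omega) (by omega)]
  by_cases hint : ∃ t : ℤ, 1 ≤ t ∧ ∃ m : ℤ, β + t * α = m
  · obtain ⟨t0, ht0, m0, hm0⟩ := hint
    have hev : ∀ᶠ k in atTop, ∀ t ∈ Finset.Ico (-(L : ℤ)) 0,
        ⌊(β + t * α) + η' k⌋ = ⌊(β + t * α) + η k⌋ := by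
      rw [Filter.eventually_all_finset]
      intro t ht
      rw [Finset.mem_Ico] at ht
      apply hnonint
      intro m hm
      have := irrational_lin_zero α hα (m0 - m) (t0 - t) (by push_cast; linarith)
      omega
    filter_upwards [hev, hlen] with k hk hLn a
    have hev0 : ∀ t : ℤ, -(L : ℤ) ≤ t → t ≤ 0 →
        ⌊(β + t * α) + η' k⌋ = ⌊(β + t * α) + η k⌋ := by
      intro t h1 h2
      rcases eq_or_lt_of_le h2 with h | h
      · rw [h]; exact hzero k
      · exact hk t (by rw [Finset.mem_Ico]; exact ⟨h1, h⟩)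
    by_cases hr : a % (n k : ℤ) + L ≤ n k
    · refine ⟨A k + a % (n k : ℤ), fun i hi => ?_⟩
      rw [hper k a i hLn hi, if_pos (by omega), add_assoc]
    · refine ⟨A k + (a % (n k : ℤ) - n k), fun i hi => ?_⟩
      rw [hper k a i hLn hi]
      split_ifs with h
      · have := hlet k (a % (n k : ℤ) + i - n k) (hev0 _ (by omega) (by omega))
          (hev0 _ (by omega) (by omega))
        rw [show (A k : ℤ) + (a % (n k : ℤ) - n k) + i = A k + (a % (n k : ℤ) + i - n k) by ring,
          ← this]
        congr 1
        ring
      · congr 1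
        ring
  · push Not at hint
    have hev : ∀ᶠ k in atTop, ∀ t ∈ Finset.Ioc (0 : ℤ) L,
        ⌊(β + t * α) + η' k⌋ = ⌊(β + t * α) + η k⌋ := by
      rw [Filter.eventually_all_finset]
      intro t ht
      rw [Finset.mem_Ioc] at ht
      exact hnonint t (hint t (by omega))
    filter_upwards [hev, hlen] with k hk hLn a
    have hev0 : ∀ t : ℤ, 0 ≤ t → t ≤ L →
        ⌊(β + t * α) + η' k⌋ = ⌊(β + t * α) + η k⌋ := by
      intro t h1 h2
      rcases eq_or_lt_of_le h1 with h | h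
      · rw [← h]; exact hzero k
      · exact hk t (by rw [Finset.mem_Ioc]; exact ⟨h, h2⟩)
    refine ⟨A k + a % (n k : ℤ), fun i hi => ?_⟩
    have hr1 : a % (n k : ℤ) < n k := Int.emod_lt_of_pos _ (by omega)
    rw [hper k a i hLn hi]
    split_ifs with h
    · rw [add_assoc]
    · have := hlet k (a % (n k : ℤ) + i - n k) (hev0 _ (by omega) (by omega))
          (hev0 _ (by omega) (by omega))
      rw [← this]
      congr 1
      ring

end Windows

/-- the spectra `σ_k` of the periodic approximations `H^{(k)}_{v,(𝔭,𝔮)}`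
(obtained by repeating the word `s^k(0)`) converge to the spectrum of `H_{v,(𝔭,𝔮)}`
in the Hausdorff metric as `k → ∞`. -/
theorem periodic_approx_spectra_tendsto (s : Bool → List Bool) (v : ℤ → Bool)
    (hv : IsSubstSeqOf s v)
    (𝔭 𝔮 : ℝ) (h𝔭 : 𝔭 ≠ 0) (hpq : (𝔭, 𝔮) ≠ (1, 0))
    (Hv : JacobiSpace →L[ℂ] JacobiSpace) (hHv : IsJacobi 𝔭 𝔮 v Hv)
    (Hk : ℕ → JacobiSpace →L[ℂ] JacobiSpace)
    (hHk : ∀ k : ℕ, IsJacobi 𝔭 𝔮 (periodicSeq (substPow s k false)) (Hk k)) :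
    Tendsto
      (fun k : ℕ => EMetric.hausdorffEdist
        {E : ℝ | (E : ℂ) ∈ spectrum ℂ (Hk k)}
        {E : ℝ | (E : ℂ) ∈ spectrum ℂ Hv})
      atTop (𝓝 0) := by
  rw [ENNReal.tendsto_nhds_zero]
  intro ε hε
  obtain ⟨δ, hδ0, hδ⟩ : ∃ δ : ℝ, 0 < δ ∧ ENNReal.ofReal δ ≤ ε := by
    by_cases hT : ε = ⊤
    · exact ⟨1, one_pos, by rw [hT]; exact le_top⟩
    · exact ⟨ε.toReal, ENNReal.toReal_pos hε.ne' hT, by rw [ENNReal.ofReal_toReal hT]⟩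
  obtain ⟨L, hL⟩ := spectrum_near_of_windows 𝔭 𝔮 δ hδ0
  filter_upwards [windows_of_sequence s v hv L, windows_of_periodic s v hv L] with k h1 h2
  refine le_trans (Metric.hausdorffEDist_le_of_mem_edist (r := ENNReal.ofReal δ) ?_ ?_) hδ
  · intro E hE
    obtain ⟨E', hE', hd⟩ := hL _ _ (Hk k) Hv (hHk k) hHv h2 E hE
    refine ⟨E', hE', ?_⟩
    rw [edist_dist, Real.dist_eq]
    exact ENNReal.ofReal_le_ofReal hd
  · intro E hE
    obtain ⟨E', hE', hd⟩ := hL _ _ Hv (Hk k) hHv (hHk k) h1 E hE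
    refine ⟨E', hE', ?_⟩
    rw [edist_dist, Real.dist_eq]
    exact ENNReal.ofReal_le_ofReal hd
end
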